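/- arXiv:1509.01345 — 4 statements merged into one kernel-verified Lean document; each statement's English description precedes it below -/
import Mathlib

section
/- For n ≥ 1 let b_{αn} = Σ_D (ℓ−1)^{ω(D)}, the sum over all squarefree monic polynomials D ∈ A of degree α·n all of whose monic irreducible factors have degree divisible by α. Then there exists a polynomial Q ∈ ℝ[X] of degree w−1 whose leading coefficient is r(K,ℓ)·(log q^α)^w/(w−1)!, such that for every ε > 0, b_{αn} = q^{αn}·Q(n) + O(q^{(α/2+ε)n}) as n → ∞. -/
open Polynomial Filter Asymptotics Topology

noncomputable section

/-- `ω(D)`: the number of distinct monic irreducible factors of `D`. -/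
noncomputable def omegaCount (Fq : Type*) [Field Fq] (D : Polynomial Fq) : ℕ :=
  Nat.card {P : Polynomial Fq // P.Monic ∧ Irreducible P ∧ P ∣ D}


abbrev MonPoly (Fq : Type*) [Field Fq] := {D : Polynomial Fq // D.Monic}
abbrev IrrPoly (Fq : Type*) [Field Fq] := {P : Polynomial Fq // P.Monic ∧ Irreducible P}

lemma hasSum_of_eq {ι : Type*} {f g : ι → ℂ} {a : ℂ} (h : HasSum f a) (e : ∀ i, g i = f i) :
    HasSum g a := by
  rwa [funext e]

lemma card_fiber (Fq : Type*) [Field Fq] [Fintype Fq] (n : ℕ) :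
    Nat.card {D : MonPoly Fq // D.1.natDegree = n} = Fintype.card Fq ^ n := by
  have e : {D : MonPoly Fq // D.1.natDegree = n} ≃ {p : Fq[X] // p.Monic ∧ p.natDegree = n} :=
    Equiv.subtypeSubtypeEquivSubtypeInter (fun D : Fq[X] => D.Monic) (fun D => D.natDegree = n)
  rw [Nat.card_congr (e.trans ((monicEquivDegreeLT n).trans (degreeLTEquiv Fq n).toEquiv))]
  simp

instance fin_fiber (Fq : Type*) [Field Fq] [Fintype Fq] (n : ℕ) :
    Finite {D : MonPoly Fq // D.1.natDegree = n} := by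
  apply Nat.finite_of_card_ne_zero
  rw [card_fiber]
  exact pow_ne_zero _ Fintype.card_ne_zero

lemma summable_monPoly_real (Fq : Type*) [Field Fq] [Fintype Fq] (x : ℝ) (hx0 : 0 ≤ x)
    (hx : Fintype.card Fq * x < 1) :
    Summable (fun D : MonPoly Fq => x ^ D.1.natDegree) := by
  rw [← (Equiv.sigmaFiberEquiv (fun D : MonPoly Fq => D.1.natDegree)).summable_iff]
  rw [summable_sigma_of_nonneg (fun _ => by simp only [Function.comp]; positivity)]
  constructor
  · intro n
    exact Summable.of_finite
  · have : Summable (fun n : ℕ => (Fintype.card Fq * x) ^ n) :=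
      summable_geometric_of_lt_one (by positivity) hx
    refine this.congr fun n => ?_
    have h : ∀ y : {D : MonPoly Fq // D.1.natDegree = n},
      ((fun D : MonPoly Fq => x ^ D.1.natDegree) ∘
        (Equiv.sigmaFiberEquiv (fun D : MonPoly Fq => D.1.natDegree))) ⟨n, y⟩ = x ^ n := by
      intro y
      simp [Equiv.sigmaFiberEquiv, y.2]
    simp_rw [h]
    rw [tsum_const, card_fiber]
    simp [mul_pow]

lemma hasSum_monPoly (Fq : Type*) [Field Fq] [Fintype Fq] (z : ℂ)
    (hz : Fintype.card Fq * ‖z‖ < 1) :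
    HasSum (fun D : MonPoly Fq => z ^ D.1.natDegree) (1 / (1 - Fintype.card Fq * z)) := by
  have hs : Summable (fun D : MonPoly Fq => z ^ D.1.natDegree) := by
    apply Summable.of_norm
    simpa using summable_monPoly_real Fq ‖z‖ (norm_nonneg _) hz
  have h1 := ((Equiv.sigmaFiberEquiv (fun D : MonPoly Fq => D.1.natDegree)).hasSum_iff.2 hs.hasSum)
  have h2 := h1.sigma (g := fun n : ℕ => (Fintype.card Fq * z) ^ n) ?_
  · have h3 : HasSum (fun n : ℕ => (Fintype.card Fq * z) ^ n) (1 - Fintype.card Fq * z)⁻¹ :=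
      hasSum_geometric_of_norm_lt_one (by simpa using hz)
    rw [one_div, ← h2.unique h3]
    exact hs.hasSum
  · intro n
    have h : ∀ y : {D : MonPoly Fq // D.1.natDegree = n},
      ((fun D : MonPoly Fq => z ^ D.1.natDegree) ∘
        (Equiv.sigmaFiberEquiv (fun D : MonPoly Fq => D.1.natDegree))) ⟨n, y⟩ = z ^ n := by
      intro y
      simp [Equiv.sigmaFiberEquiv, y.2]
    simp_rw [h]
    have := Fintype.ofFinite {D : MonPoly Fq // D.1.natDegree = n}
    have h5 := hasSum_fintype (fun y : {D : MonPoly Fq // D.1.natDegree = n} => z ^ n)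
    rw [Finset.sum_const, Finset.card_univ, ← Nat.card_eq_fintype_card, card_fiber] at h5
    rw [mul_pow]
    simpa using h5

open Classical in
/-- sieving finitely many primes -/
lemma hasSum_sieve (Fq : Type*) [Field Fq] [Fintype Fq] (z : ℂ)
    (hz : Fintype.card Fq * ‖z‖ < 1) (S : Finset (IrrPoly Fq)) :
    HasSum (fun D : MonPoly Fq => if ∀ P ∈ S, ¬ P.1 ∣ D.1 then z ^ D.1.natDegree else 0)
      ((1 / (1 - Fintype.card Fq * z)) * ∏ P ∈ S, (1 - z ^ P.1.natDegree)) := by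
  induction S using Finset.induction_on with
  | empty => simpa using hasSum_monPoly Fq z hz
  | insert P S hP ih =>
    rw [Finset.prod_insert hP]
    -- those divisible by P
    let m : MonPoly Fq → MonPoly Fq := fun D => ⟨P.1 * D.1, P.2.1.mul D.2⟩
    have hm : Function.Injective m := by
      intro D E h
      have := congrArg Subtype.val h
      exact Subtype.ext (mul_left_cancel₀ P.2.1.ne_zero this)
    have key : HasSum (fun D : MonPoly Fq =>
        if P.1 ∣ D.1 ∧ ∀ R ∈ S, ¬ R.1 ∣ D.1 then z ^ D.1.natDegree else 0)
        (z ^ P.1.natDegree * ((1 / (1 - Fintype.card Fq * z)) *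
          ∏ P ∈ S, (1 - z ^ P.1.natDegree))) := by
      rw [← hm.hasSum_iff]
      · refine hasSum_of_eq (ih.mul_left (z ^ P.1.natDegree)) fun D => ?_
        have h1 : (∀ R ∈ S, ¬ R.1 ∣ P.1 * D.1) ↔ ∀ R ∈ S, ¬ R.1 ∣ D.1 := by
          refine forall₂_congr fun R hR => not_congr ⟨fun h => ?_, fun h => h.mul_left _⟩
          rcases R.2.2.prime.dvd_or_dvd h with h | h
          · exfalso
            apply hP
            have : R.1 = P.1 := eq_of_monic_of_associated R.2.1 P.2.1
              (R.2.2.associated_of_dvd P.2.2 h)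
            rwa [← Subtype.ext this]
          · exact h
        simp only [Function.comp, m, h1, dvd_mul_right, true_and]
        split_ifs
        · rw [P.2.1.natDegree_mul D.2, pow_add]
        · simp
      · intro D hD
        rw [if_neg]
        rintro ⟨⟨E, hE⟩, -⟩
        apply hD
        have hEm : E.Monic := P.2.1.of_mul_monic_left (hE ▸ D.2)
        exact ⟨⟨E, hEm⟩, Subtype.ext hE.symm⟩
    have e : ((1 / (1 - Fintype.card Fq * z)) * ((1 - z ^ P.1.natDegree) *
        ∏ P ∈ S, (1 - z ^ P.1.natDegree))) = (1 / (1 - Fintype.card Fq * z)) *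
        (∏ P ∈ S, (1 - z ^ P.1.natDegree)) - (z ^ P.1.natDegree * ((1 / (1 - Fintype.card Fq * z)) *
          ∏ P ∈ S, (1 - z ^ P.1.natDegree))) := by ring
    rw [e]
    refine hasSum_of_eq (ih.sub key) fun D => ?_
    simp only [Finset.mem_insert, forall_eq_or_imp]
    split_ifs <;> simp_all

lemma hasProd_irr (Fq : Type*) [Field Fq] [Fintype Fq] (z : ℂ)
    (hz : Fintype.card Fq * ‖z‖ < 1) :
    HasProd (fun P : IrrPoly Fq => 1 - z ^ P.1.natDegree) (1 - Fintype.card Fq * z) := by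
  classical
  have hne : 1 - Fintype.card Fq * z ≠ 0 := by
    intro h
    have : ‖(Fintype.card Fq : ℂ) * z‖ = 1 := by
      rw [← sub_eq_zero.1 h]; simp
    simp at this
    linarith
  have h1 : Tendsto (fun S : Finset (IrrPoly Fq) => ∑' D : MonPoly Fq,
      if ∀ P ∈ S, ¬ P.1 ∣ D.1 then z ^ D.1.natDegree else 0) atTop
      (𝓝 (∑' D : MonPoly Fq, if D.1 = 1 then 1 else 0)) := by
    apply tendsto_tsum_of_dominated_convergence
      (summable_monPoly_real Fq ‖z‖ (norm_nonneg _) hz)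
    · intro D
      apply tendsto_const_nhds.congr'
      by_cases hD : D.1 = 1
      · refine Eventually.of_forall fun S => ?_
        simp only [hD, natDegree_one, pow_zero, if_true]
        rw [if_pos]
        intro P _ h
        exact P.2.2.not_isUnit (isUnit_of_dvd_one h)
      · have hu : ¬ IsUnit D.1 := fun h => hD (D.2.eq_one_of_isUnit h)
        obtain ⟨P, hPm, hPi, hPd⟩ := exists_monic_irreducible_factor D.1 hu
        filter_upwards [eventually_ge_atTop ({⟨P, hPm, hPi⟩} : Finset (IrrPoly Fq))] with S hS
        rw [if_neg hD, if_neg]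
        intro h
        exact h ⟨P, hPm, hPi⟩ (hS (by simp)) hPd
    · refine Eventually.of_forall fun S D => ?_
      split_ifs <;> simp
  have h2 : (∑' D : MonPoly Fq, if D.1 = 1 then (1:ℂ) else 0) = 1 := by
    rw [tsum_eq_single ⟨1, monic_one⟩]
    · simp
    · intro D hD
      rw [if_neg]
      exact fun h => hD (Subtype.ext h)
  rw [h2] at h1
  simp_rw [(hasSum_sieve Fq z hz _).tsum_eq] at h1
  have h3 := h1.const_mul (1 - Fintype.card Fq * z)
  rw [HasProd, SummationFilter.unconditional_filter]
  convert h3 using 1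
  · ext S
    field_simp
  · simp


lemma prod_range_root {m : ℕ} (hm : 0 < m) {ξ : ℂ} (hξ : IsPrimitiveRoot ξ m) (y : ℂ) :
    ∏ k ∈ Finset.range m, (1 - ξ ^ k * y) = 1 - y ^ m := by
  have h := hξ.pow_sub_pow_eq_prod_sub_mul 1 y hm
  rw [one_pow] at h
  rw [h]
  have : NeZero m := ⟨hm.ne'⟩
  have e : (nthRootsFinset m (1:ℂ)) = (Finset.range m).image (fun k => ξ ^ k) := by
    symm
    apply Finset.eq_of_subset_of_card_le
    · intro x hx
      obtain ⟨k, -, rfl⟩ := Finset.mem_image.1 hx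
      rw [mem_nthRootsFinset hm, ← pow_mul, mul_comm, pow_mul, hξ.pow_eq_one, one_pow]
    · rw [hξ.card_nthRootsFinset, Finset.card_image_of_injOn, Finset.card_range]
      intro a ha b hb hab
      exact hξ.pow_inj (by simpa using ha) (by simpa using hb) hab
  rw [e, Finset.prod_image]
  intro a ha b hb hab
  exact hξ.pow_inj (by simpa using ha) (by simpa using hb) hab

lemma prod_range_periodic (h : ℕ → ℂ) (m g : ℕ) (hp : ∀ k, h (k + m) = h k) :
    ∏ k ∈ Finset.range (m * g), h k = (∏ k ∈ Finset.range m, h k) ^ g := by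
  have hp' : ∀ g k, h (m * g + k) = h k := by
    intro g
    induction g with
    | zero => simp
    | succ g ih =>
      intro k
      rw [← ih k, ← hp (m * g + k)]
      congr 1; ring
  induction g with
  | zero => simp
  | succ g ih =>
    rw [mul_add_one, Finset.prod_range_add, ih, pow_succ]
    congr 1
    exact Finset.prod_congr rfl fun k _ => hp' g k

lemma prod_twist {α : ℕ} (hα : 0 < α) {ζ : ℂ} (hζ : IsPrimitiveRoot ζ α) (u : ℂ) (d : ℕ) :
    ∏ j ∈ Finset.range α, (1 - (ζ ^ j * u) ^ d) =
      (1 - (u ^ α) ^ (d / Nat.gcd α d)) ^ (Nat.gcd α d) := by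
  set g := Nat.gcd α d with hg
  have hgpos : 0 < g := Nat.gcd_pos_of_pos_left _ hα
  obtain ⟨m, hm⟩ : g ∣ α := Nat.gcd_dvd_left _ _
  obtain ⟨e, he⟩ : g ∣ d := Nat.gcd_dvd_right _ _
  have hmpos : 0 < m := Nat.pos_of_ne_zero (by rintro rfl; simp at hm; omega)
  have hξ : IsPrimitiveRoot (ζ ^ d) m := by
    have h1 : orderOf (ζ ^ d) = m := by
      rw [IsOfFinOrder.orderOf_pow _ _ (isOfFinOrder_iff_pow_eq_one.2 ⟨α, hα, hζ.pow_eq_one⟩), ← hζ.eq_orderOf, ← hg, hm, Nat.mul_div_cancel_left _ hgpos]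
    rw [← h1]
    exact IsPrimitiveRoot.orderOf _
  have hde : d / g = e := by rw [he, Nat.mul_div_cancel_left _ hgpos]
  rw [hde]
  have h2 : ∀ j, (1 - (ζ ^ j * u) ^ d) = 1 - (ζ ^ d) ^ j * u ^ d := by
    intro j; rw [mul_pow]; ring
  simp_rw [h2]
  have h3 := prod_range_periodic (fun j => 1 - (ζ ^ d) ^ j * u ^ d) m g
    (fun k => by simp only [pow_add, hξ.pow_eq_one, mul_one])
  have h4 : Finset.range α = Finset.range (m * g) := by rw [hm, mul_comm]
  rw [h4, h3, prod_range_root hmpos hξ]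
  congr 2
  rw [← pow_mul, ← pow_mul]
  congr 1
  rw [hm, he]; ring

lemma hasProd_irr_pow (Fq : Type*) [Field Fq] [Fintype Fq] {α : ℕ} (hα : 0 < α) (v : ℂ)
    (hv : (Fintype.card Fq : ℝ) ^ α * ‖v‖ < 1) :
    HasProd (fun P : IrrPoly Fq => (1 - v ^ (P.1.natDegree / Nat.gcd α P.1.natDegree)) ^
      (Nat.gcd α P.1.natDegree)) (1 - (Fintype.card Fq : ℂ) ^ α * v) := by
  obtain ⟨u, rfl⟩ := IsAlgClosed.exists_pow_nat_eq v hα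
  have hζ : IsPrimitiveRoot (Complex.exp (2 * Real.pi * Complex.I / α)) α :=
    Complex.isPrimitiveRoot_exp α hα.ne'
  set ζ := (Complex.exp (2 * Real.pi * Complex.I / α))
  have hζn : ‖ζ‖ = 1 := hζ.norm'_eq_one hα.ne'
  have hu : (Fintype.card Fq : ℝ) * ‖u‖ < 1 := by
    rw [norm_pow, ← mul_pow] at hv
    by_contra! h
    exact absurd hv (not_lt.2 (one_le_pow₀ h))
  have h := hasProd_prod (s := Finset.range α)
    (f := fun j (P : IrrPoly Fq) => 1 - (ζ ^ j * u) ^ P.1.natDegree)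
    (a := fun j => 1 - Fintype.card Fq * (ζ ^ j * u)) (fun j _ => hasProd_irr Fq _ (by
      simpa [hζn] using hu))
  simp_rw [prod_twist hα hζ] at h
  have h2 : ∏ j ∈ Finset.range α, (1 - Fintype.card Fq * (ζ ^ j * u)) =
      (1 - (Fintype.card Fq : ℂ) ^ α * u ^ α) := by
    rw [← mul_pow, ← prod_range_root hα hζ]
    exact Finset.prod_congr rfl fun j _ => by ring
  rwa [h2] at h


def kk (α d : ℕ) : ℕ := d / Nat.gcd α d

def fterm (n α d : ℕ) (v : ℂ) : ℂ := if α ∣ d then (n : ℂ) * v ^ kk α d else 0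

def gterm (n w α d : ℕ) (v : ℂ) : ℂ :=
  (1 + fterm n α d v) * ((1 - v ^ kk α d) ^ Nat.gcd α d) ^ w - 1

lemma bound_one (N : ℕ) (x : ℂ) (hx : ‖x‖ ≤ 1) : ‖(1 - x) ^ N - 1‖ ≤ 3 ^ N * ‖x‖ := by
  induction N with
  | zero => simp
  | succ N ih =>
    have e : (1 - x) ^ (N + 1) - 1 = (1 - x) * ((1 - x) ^ N - 1) - x := by ring
    have h1 : ‖1 - x‖ ≤ 2 := (norm_sub_le _ _).trans (by simp; linarith)
    have h3 : (1 : ℝ) ≤ 3 ^ N := one_le_pow₀ (by norm_num)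
    rw [e]
    calc _ ≤ ‖1 - x‖ * ‖(1 - x) ^ N - 1‖ + ‖x‖ := by
            rw [← norm_mul]; exact norm_sub_le _ _
      _ ≤ 2 * (3 ^ N * ‖x‖) + 3 ^ N * ‖x‖ := by
            gcongr
            exact le_mul_of_one_le_left (norm_nonneg _) h3
      _ = _ := by ring

lemma bound_two (n : ℕ) : ∃ C : ℝ, 0 ≤ C ∧ ∀ x : ℂ, ‖x‖ ≤ 1 →
    ‖(1 - x) ^ n - 1 + n * x‖ ≤ C * ‖x‖ ^ 2 := by
  induction n with
  | zero => exact ⟨0, le_rfl, fun x _ => by simp⟩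
  | succ n ih =>
    obtain ⟨C, hC, h⟩ := ih
    refine ⟨2 * C + n, by positivity, fun x hx => ?_⟩
    have e : (1 - x) ^ (n + 1) - 1 + (n + 1 : ℕ) * x =
      (1 - x) * ((1 - x) ^ n - 1 + n * x) + n * x ^ 2 := by push_cast; ring
    have h1 : ‖1 - x‖ ≤ 2 := (norm_sub_le _ _).trans (by simp; linarith)
    rw [e]
    calc _ ≤ ‖1 - x‖ * ‖(1 - x) ^ n - 1 + n * x‖ + n * ‖x‖ ^ 2 := by
            rw [← norm_mul]
            refine (norm_add_le _ _).trans ?_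
            simp
      _ ≤ 2 * (C * ‖x‖ ^ 2) + n * ‖x‖ ^ 2 := by gcongr; exact h x hx
      _ = _ := by ring

lemma bound_three (n : ℕ) : ∃ C : ℝ, 0 ≤ C ∧ ∀ x : ℂ, ‖x‖ ≤ 1 →
    ‖(1 + n * x) * (1 - x) ^ n - 1‖ ≤ C * ‖x‖ ^ 2 := by
  obtain ⟨C, hC, h⟩ := bound_two n
  refine ⟨(1 + n) * C + n ^ 2, by positivity, fun x hx => ?_⟩
  have e : (1 + n * x) * (1 - x) ^ n - 1 =
    (1 + n * x) * ((1 - x) ^ n - 1 + n * x) - n ^ 2 * x ^ 2 := by ring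
  have h1 : ‖1 + n * x‖ ≤ 1 + n := by
    refine (norm_add_le _ _).trans ?_
    simp
    exact mul_le_of_le_one_right (by positivity) hx
  rw [e]
  calc _ ≤ ‖1 + n * x‖ * ‖(1 - x) ^ n - 1 + n * x‖ + n ^ 2 * ‖x‖ ^ 2 := by
          rw [← norm_mul]
          refine (norm_sub_le _ _).trans ?_
          simp
    _ ≤ (1 + n) * (C * ‖x‖ ^ 2) + n ^ 2 * ‖x‖ ^ 2 := by gcongr; exact h x hx
    _ = _ := by ring

lemma gterm_bound {α w : ℕ} (hα : 0 < α) : ∃ C : ℝ, 0 ≤ C ∧ ∀ (y : ℝ) (v : ℂ) (d : ℕ),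
    0 ≤ y → y ≤ 1 → ‖v‖ ≤ y ^ α → 0 < d → ‖gterm (α * w) w α d v‖ ≤ C * (y ^ 2) ^ d := by
  obtain ⟨C, hC, h⟩ := bound_three (α * w)
  refine ⟨C + 3 ^ (α * w), by positivity, fun y v d hy0 hy1 hv hd => ?_⟩
  have hv1 : ‖v‖ ≤ 1 := hv.trans (pow_le_one₀ hy0 hy1)
  have hx1 : ∀ k, ‖v ^ k‖ ≤ 1 := fun k => by
    rw [norm_pow]; exact pow_le_one₀ (norm_nonneg _) hv1
  have hvk : ∀ k, ‖v ^ k‖ ≤ y ^ (α * k) := fun k => by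
    rw [norm_pow, pow_mul]; gcongr
  have hg : 0 < Nat.gcd α d := Nat.gcd_pos_of_pos_left _ hα
  unfold gterm fterm
  rw [← pow_mul]
  have hsp : 0 ≤ (y ^ 2) ^ d := by positivity
  by_cases hd' : α ∣ d
  · rw [if_pos hd', Nat.gcd_eq_left hd', kk, Nat.gcd_eq_left hd']
    calc _ ≤ C * ‖v ^ (d / α)‖ ^ 2 := h _ (hx1 _)
      _ ≤ C * (y ^ (α * (d / α))) ^ 2 := by gcongr; exact hvk _
      _ = C * (y ^ 2) ^ d := by rw [Nat.mul_div_cancel' hd']; ring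
      _ ≤ _ := by gcongr; linarith [show (0:ℝ) ≤ 3 ^ (α * w) by positivity]
  · rw [if_neg hd', add_zero, one_mul]
    have hN : Nat.gcd α d * w ≤ α * w := Nat.mul_le_mul_right _ (Nat.gcd_le_left _ hα)
    have hk : 2 * d ≤ α * kk α d := by
      unfold kk
      rw [← Nat.mul_div_assoc _ (Nat.gcd_dvd_right α d)]
      change 2 * d ≤ Nat.lcm α d
      obtain ⟨c, hc⟩ := Nat.dvd_lcm_right α d
      have h0 : Nat.lcm α d ≠ 0 := Nat.lcm_ne_zero hα.ne' hd.ne'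
      have : c ≠ 0 := by rintro rfl; simp [hc] at h0
      have : c ≠ 1 := by
        rintro rfl
        apply hd'
        have := Nat.dvd_lcm_left α d
        rwa [hc, mul_one] at this
      rw [hc, mul_comm]
      exact Nat.mul_le_mul_left _ (by omega)
    calc _ ≤ 3 ^ (Nat.gcd α d * w) * ‖v ^ kk α d‖ := bound_one _ _ (hx1 _)
      _ ≤ 3 ^ (α * w) * y ^ (α * kk α d) := by
          gcongr
          · norm_num
          · exact hvk _
      _ ≤ 3 ^ (α * w) * y ^ (2 * d) := by
          gcongr 3 ^ (α * w) * ?_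
          exact pow_le_pow_of_le_one hy0 hy1 hk
      _ = 3 ^ (α * w) * (y ^ 2) ^ d := by rw [← pow_mul y]
      _ ≤ _ := by gcongr; linarith

lemma IrrPoly.natDegree_pos {Fq : Type*} [Field Fq] (P : IrrPoly Fq) : 0 < P.1.natDegree :=
  P.2.2.natDegree_pos

lemma summable_irrPoly_real (Fq : Type*) [Field Fq] [Fintype Fq] (x : ℝ) (hx0 : 0 ≤ x)
    (hx : Fintype.card Fq * x < 1) :
    Summable (fun P : IrrPoly Fq => x ^ P.1.natDegree) := by
  have h := summable_monPoly_real Fq x hx0 hx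
  exact h.comp_injective (i := fun P : IrrPoly Fq => (⟨P.1, P.2.1⟩ : MonPoly Fq))
    (fun P R h => Subtype.ext (by simpa using h))

def bigG (Fq : Type*) [Field Fq] (w α : ℕ) (v : ℂ) : ℂ :=
  ∏' P : IrrPoly Fq, (1 + gterm (α * w) w α P.1.natDegree v)

lemma y_le_one (Fq : Type*) [Field Fq] [Fintype Fq] {y : ℝ} (hy : 0 ≤ y)
    (h : Fintype.card Fq * y ^ 2 < 1) : y ≤ 1 := by
  by_contra! h1
  have : (1:ℝ) ≤ Fintype.card Fq := by exact_mod_cast Fintype.card_pos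
  nlinarith [mul_self_nonneg y]

lemma bigG_diff (Fq : Type*) [Field Fq] [Fintype Fq] (w : ℕ) {α : ℕ} (hα : 0 < α) {y : ℝ} (hy : 0 < y)
    (h : Fintype.card Fq * y ^ 2 < 1) :
    DifferentiableOn ℂ (bigG Fq w α) (Metric.ball 0 (y ^ α)) := by
  obtain ⟨C, hC, hb⟩ := gterm_bound (w := w) hα
  have hsum := (summable_irrPoly_real Fq (y ^ 2) (by positivity) h).mul_left C
  have hc : ∀ (P : IrrPoly Fq), Differentiable ℂ (fun v => gterm (α * w) w α P.1.natDegree v) := by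
    intro P
    unfold gterm fterm
    split_ifs <;> fun_prop
  have := (Summable.hasProdLocallyUniformlyOn_one_add (hu := hsum)
    (f := fun (P : IrrPoly Fq) v => gterm (α * w) w α P.1.natDegree v)
    (K := Metric.ball (0:ℂ) (y ^ α)) Metric.isOpen_ball
    (Eventually.of_forall fun P v hv => hb y v _ hy.le (y_le_one Fq hy.le h)
      (by simpa using (Metric.mem_ball.1 hv).le) P.natDegree_pos)
    (fun P => (hc P).continuous.continuousOn))
  rw [hasProdLocallyUniformlyOn_iff_tendstoLocallyUniformlyOn] at this
  refine this.differentiableOn (Eventually.of_forall fun S => ?_) Metric.isOpen_ball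
  apply Differentiable.differentiableOn
  refine Differentiable.fun_finsetProd fun P _ => ?_
  exact (differentiable_const _).add (hc P)

lemma bigG_summable (Fq : Type*) [Field Fq] [Fintype Fq] (w : ℕ) {α : ℕ} (hα : 0 < α) {y : ℝ} (hy : 0 ≤ y)
    (h : Fintype.card Fq * y ^ 2 < 1) (v : ℂ) (hv : ‖v‖ ≤ y ^ α) :
    Summable (fun P : IrrPoly Fq => ‖gterm (α * w) w α P.1.natDegree v‖) := by
  obtain ⟨C, hC, hb⟩ := gterm_bound (w := w) hα
  have hsum := (summable_irrPoly_real Fq (y ^ 2) (by positivity) h).mul_left C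
  exact Summable.of_nonneg_of_le (fun _ => norm_nonneg _) (fun P => hb y v _ hy (y_le_one Fq hy h)
      hv P.natDegree_pos) hsum

/-- real points -/
lemma bigG_ne_zero (Fq : Type*) [Field Fq] [Fintype Fq] (w : ℕ) {α : ℕ} (hα : 0 < α) {y : ℝ} (hy : 0 ≤ y)
    (h : Fintype.card Fq * y ^ 2 < 1) :
    bigG Fq w α ((y ^ α : ℝ) : ℂ) ≠ 0 := by
  apply tprod_one_add_ne_zero_of_summable
  · intro P
    have hy1 : y < 1 := by
      have : (1:ℝ) ≤ Fintype.card Fq := by exact_mod_cast Fintype.card_pos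
      nlinarith [mul_self_nonneg y]
    have hgp : 0 < Nat.gcd α P.1.natDegree := Nat.gcd_pos_of_pos_left _ hα
    have hk : kk α P.1.natDegree ≠ 0 := by
      unfold kk
      exact (Nat.div_pos (Nat.gcd_le_right _ P.natDegree_pos) hgp).ne'
    have h1 : (y ^ α) ^ (kk α P.1.natDegree) < 1 :=
      pow_lt_one₀ (by positivity) (pow_lt_one₀ hy hy1 hα.ne') hk
    unfold gterm fterm
    rw [add_sub_cancel]
    refine mul_ne_zero ?_ (pow_ne_zero _ (pow_ne_zero _ ?_))
    · split_ifs
      · have : (0:ℝ) < 1 + (α * w : ℕ) * (y ^ α) ^ (kk α P.1.natDegree) := by positivity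
        exact_mod_cast this.ne'
      · simp
    · have : (0:ℝ) < 1 - (y ^ α) ^ (kk α P.1.natDegree) := by linarith
      exact_mod_cast this.ne'
  · exact bigG_summable Fq w hα hy h _ (by
      rw [Complex.norm_real, Real.norm_of_nonneg (by positivity)])

lemma fterm_summable (Fq : Type*) [Field Fq] [Fintype Fq] (n : ℕ) {α : ℕ} (hα : 0 < α) (v : ℂ)
    (hv : (Fintype.card Fq : ℝ) ^ α * ‖v‖ < 1) :
    Summable (fun P : IrrPoly Fq => ‖fterm n α P.1.natDegree v‖) := by
  obtain ⟨u, rfl⟩ := IsAlgClosed.exists_pow_nat_eq v hα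
  have hu : (Fintype.card Fq : ℝ) * ‖u‖ < 1 := by
    rw [norm_pow, ← mul_pow] at hv
    by_contra! h
    exact absurd hv (not_lt.2 (one_le_pow₀ h))
  refine Summable.of_nonneg_of_le (fun _ => norm_nonneg _) (fun P => ?_)
    ((summable_irrPoly_real Fq ‖u‖ (norm_nonneg _) hu).mul_left (n:ℝ))
  unfold fterm
  split_ifs with h
  · rw [kk, Nat.gcd_eq_left h, ← pow_mul, Nat.mul_div_cancel' h]
    simp
  · simp; positivity

lemma bigG_eq (Fq : Type*) [Field Fq] [Fintype Fq] (w : ℕ) {α : ℕ} (hα : 0 < α) (v : ℂ)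
    (hv : (Fintype.card Fq : ℝ) ^ α * ‖v‖ < 1) :
    bigG Fq w α v = (∏' P : IrrPoly Fq, (1 + fterm (α * w) α P.1.natDegree v)) *
      (1 - (Fintype.card Fq : ℂ) ^ α * v) ^ w := by
  have h1 := (multipliable_one_add_of_summable (fterm_summable Fq (α * w) hα v hv)).hasProd
  have h2 := hasProd_prod (s := Finset.range w) (fun _ _ => hasProd_irr_pow Fq hα v hv)
  simp only [Finset.prod_const, Finset.card_range] at h2
  have h3 := (h1.mul h2).tprod_eq
  rw [← h3]
  unfold bigG gterm kk
  simp


def prodS {Fq : Type*} [Field Fq] (S : Finset (IrrPoly Fq)) : MonPoly Fq :=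
  ⟨∏ P ∈ S, P.1, monic_prod_of_monic _ _ fun P _ => P.2.1⟩

lemma irr_eq {Fq : Type*} [Field Fq] {P R : Fq[X]} (hP : P.Monic) (hR : R.Monic)
    (hPi : Irreducible P) (hRi : Irreducible R) (h : P ∣ R) : P = R :=
  eq_of_monic_of_associated hP hR (hPi.associated_of_dvd hRi h)

lemma dvd_prodS {Fq : Type*} [Field Fq] (S : Finset (IrrPoly Fq)) (P : IrrPoly Fq) :
    P.1 ∣ (prodS S).1 ↔ P ∈ S := by
  constructor
  · intro h
    obtain ⟨R, hR, h⟩ := (P.2.2.prime.dvd_finsetProd_iff _).1 h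
    have : P = R := Subtype.ext (irr_eq P.2.1 R.2.1 P.2.2 R.2.2 h)
    rwa [this]
  · intro h
    exact Finset.dvd_prod_of_mem (fun P : IrrPoly Fq => P.1) h

lemma prodS_injective {Fq : Type*} [Field Fq] :
    Function.Injective (prodS : Finset (IrrPoly Fq) → MonPoly Fq) := by
  intro S T h
  ext P
  rw [← dvd_prodS S, ← dvd_prodS T, h]

lemma prodS_squarefree {Fq : Type*} [Field Fq] (S : Finset (IrrPoly Fq)) :
    Squarefree (prodS S).1 := by
  classical
  induction S using Finset.induction_on with
  | empty => simp [prodS]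
  | insert P S hP ih =>
    have e : (prodS (insert P S)).1 = P.1 * (prodS S).1 := by
      simp [prodS, Finset.prod_insert hP]
    rw [e]
    refine (squarefree_mul_iff).2 ⟨?_, P.2.2.squarefree, ih⟩
    apply IsCoprime.isRelPrime
    rw [P.2.2.coprime_iff_not_dvd, dvd_prodS]
    exact hP

lemma prodS_surj {Fq : Type*} [Field Fq] (n : ℕ) : ∀ (D : MonPoly Fq), D.1.natDegree = n →
    Squarefree D.1 → ∃ S, prodS S = D := by
  classical
  induction n using Nat.strong_induction_on with
  | _ n ih =>
  intro D hn hD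
  by_cases h1 : D.1 = 1
  · exact ⟨∅, Subtype.ext (by simp [prodS, h1])⟩
  have hu : ¬ IsUnit D.1 := fun h => h1 (D.2.eq_one_of_isUnit h)
  obtain ⟨P, hPm, hPi, E, hE⟩ := exists_monic_irreducible_factor D.1 hu
  have hEm : E.Monic := hPm.of_mul_monic_left (hE ▸ D.2)
  rw [hE] at hD
  have hdeg : E.natDegree < n := by
    rw [← hn, hE, hPm.natDegree_mul hEm]
    have := hPi.natDegree_pos
    omega
  obtain ⟨S, hS⟩ := ih _ hdeg ⟨E, hEm⟩ rfl (hD.squarefree_of_dvd (dvd_mul_left _ _))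
  have hS' : (prodS S).1 = E := congrArg Subtype.val hS
  have hPS : (⟨P, hPm, hPi⟩ : IrrPoly Fq) ∉ S := by
    rw [← dvd_prodS, hS']
    intro h
    exact hPi.not_isUnit (hD P (mul_dvd_mul_left _ h))
  refine ⟨insert ⟨P, hPm, hPi⟩ S, Subtype.ext ?_⟩
  rw [hE, ← hS']
  simp [prodS, Finset.prod_insert hPS]

lemma omega_prodS {Fq : Type*} [Field Fq] (S : Finset (IrrPoly Fq)) :
    omegaCount Fq (prodS S).1 = S.card := by
  unfold omegaCount
  have e : {P : Polynomial Fq // P.Monic ∧ Irreducible P ∧ P ∣ (prodS S).1} ≃ {x // x ∈ S} :=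
    { toFun := fun P => ⟨⟨P.1, P.2.1, P.2.2.1⟩, (dvd_prodS S _).1 P.2.2.2⟩
      invFun := fun x => ⟨x.1.1, x.1.2.1, x.1.2.2, (dvd_prodS S _).2 x.2⟩
      left_inv := fun P => rfl
      right_inv := fun x => rfl }
  rw [Nat.card_congr e]
  simp

def goodD {Fq : Type*} [Field Fq] (α : ℕ) (D : Fq[X]) : Prop :=
  Squarefree D ∧ ∀ P : Polynomial Fq, P.Monic → Irreducible P → P ∣ D → α ∣ P.natDegree

lemma goodD_prodS {Fq : Type*} [Field Fq] (α : ℕ) (S : Finset (IrrPoly Fq)) :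
    goodD α (prodS S).1 ↔ ∀ P ∈ S, α ∣ P.1.natDegree := by
  constructor
  · rintro ⟨-, h⟩ P hP
    exact h P.1 P.2.1 P.2.2 ((dvd_prodS S P).2 hP)
  · intro h
    refine ⟨prodS_squarefree S, fun P hm hi hd => ?_⟩
    exact h ⟨P, hm, hi⟩ ((dvd_prodS S ⟨P, hm, hi⟩).1 hd)

lemma natDegree_prodS {Fq : Type*} [Field Fq] (S : Finset (IrrPoly Fq)) :
    (prodS S).1.natDegree = ∑ P ∈ S, P.1.natDegree :=
  natDegree_prod_of_monic _ _ fun P _ => P.2.1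

open Classical in
def hterm {Fq : Type*} [Field Fq] (n α : ℕ) (v : ℂ) (D : MonPoly Fq) : ℂ :=
  if goodD α D.1 then (n : ℂ) ^ omegaCount Fq D.1 * v ^ (D.1.natDegree / α) else 0

lemma prod_fterm {Fq : Type*} [Field Fq] (n : ℕ) {α : ℕ} (v : ℂ)
    (S : Finset (IrrPoly Fq)) :
    ∏ P ∈ S, fterm n α P.1.natDegree v = hterm n α v (prodS S) := by
  unfold hterm
  by_cases h : goodD α (prodS S).1
  · rw [if_pos h, omega_prodS, natDegree_prodS]
    rw [goodD_prodS] at h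
    rw [Nat.sum_div h, ← Finset.prod_pow_eq_pow_sum, ← Finset.prod_const,
      ← Finset.prod_mul_distrib]
    refine Finset.prod_congr rfl fun P hP => ?_
    rw [fterm, if_pos (h P hP), kk, Nat.gcd_eq_left (h P hP)]
  · rw [if_neg h]
    rw [goodD_prodS] at h
    push Not at h
    obtain ⟨P, hP, h⟩ := h
    exact Finset.prod_eq_zero hP (by rw [fterm, if_neg h])

def bb (Fq : Type*) [Field Fq] (n α m : ℕ) : ℝ :=
  ∑ᶠ D ∈ {D : Polynomial Fq | D.Monic ∧ Squarefree D ∧ D.natDegree = α * m ∧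
                ∀ P : Polynomial Fq, P.Monic → Irreducible P → P ∣ D → α ∣ P.natDegree},
              (n : ℝ) ^ omegaCount Fq D

lemma fiber_hasSum (Fq : Type*) [Field Fq] [Fintype Fq] (n : ℕ) {α : ℕ} (hα : 0 < α) (v : ℂ) (m : ℕ) :
    HasSum (fun y : {D : MonPoly Fq // D.1.natDegree = α * m} => hterm n α v y.1)
      ((bb Fq n α m : ℂ) * v ^ m) := by
  classical
  have := Fintype.ofFinite {D : MonPoly Fq // D.1.natDegree = α * m}
  have h5 := hasSum_fintype (fun y : {D : MonPoly Fq // D.1.natDegree = α * m} => hterm n α v y.1)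
  have e : (∑ y : {D : MonPoly Fq // D.1.natDegree = α * m}, hterm n α v y.1) =
      (bb Fq n α m : ℂ) * v ^ m := by
    set s := {D : Polynomial Fq | D.Monic ∧ Squarefree D ∧ D.natDegree = α * m ∧
                ∀ P : Polynomial Fq, P.Monic → Irreducible P → P ∣ D → α ∣ P.natDegree} with hs
    let i : {D : MonPoly Fq // D.1.natDegree = α * m} → Fq[X] := fun y => y.1.1
    have hi : Function.Injective i := fun a b h => Subtype.ext (Subtype.ext h)
    have hsub : s ⊆ Set.range i := by
      rintro D ⟨h1, h2, h3, h4⟩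
      exact ⟨⟨⟨D, h1⟩, h3⟩, rfl⟩
    have hb : bb Fq n α m = ∑ y : {D : MonPoly Fq // D.1.natDegree = α * m},
        if goodD α y.1.1 then (n : ℝ) ^ omegaCount Fq y.1.1 else 0 := by
      rw [bb, ← hs, finsum_mem_def]
      have : s.indicator (fun D => (n : ℝ) ^ omegaCount Fq D) =
        (Set.range i).indicator (s.indicator (fun D => (n : ℝ) ^ omegaCount Fq D)) := by
        rw [Set.indicator_indicator, Set.inter_eq_right.2 hsub]
      rw [this, ← finsum_mem_def, finsum_mem_range hi, finsum_eq_sum_of_fintype]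
      refine Finset.sum_congr rfl fun y _ => ?_
      have : i y ∈ s ↔ goodD α y.1.1 := by
        constructor
        · rintro ⟨h1, h2, h3, h4⟩
          exact ⟨h2, h4⟩
        · rintro ⟨h2, h4⟩
          exact ⟨y.1.2, h2, y.2, h4⟩
      rw [Set.indicator_apply]
      simp only [this]
      rfl
    rw [hb]
    push_cast
    rw [Finset.sum_mul]
    refine Finset.sum_congr rfl fun y _ => ?_
    rw [hterm, y.2, Nat.mul_div_cancel_left _ hα]
    split_ifs <;> simp
  rwa [e] at h5

lemma goodD_dvd {Fq : Type*} [Field Fq] (α : ℕ) (D : MonPoly Fq) (h : goodD α D.1) :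
    α ∣ D.1.natDegree := by
  obtain ⟨S, rfl⟩ := prodS_surj _ D rfl h.1
  rw [goodD_prodS] at h
  rw [natDegree_prodS]
  exact Finset.dvd_sum h

lemma hasSum_bb (Fq : Type*) [Field Fq] [Fintype Fq] (n : ℕ) {α : ℕ} (hα : 0 < α) (v : ℂ)
    (hv : (Fintype.card Fq : ℝ) ^ α * ‖v‖ < 1) :
    HasSum (fun m : ℕ => (bb Fq n α m : ℂ) * v ^ m)
      (∏' P : IrrPoly Fq, (1 + fterm n α P.1.natDegree v)) := by
  have h1 := summable_finsetProd_of_summable_norm (fterm_summable Fq n hα v hv)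
  rw [tprod_one_add h1]
  set a := ∑' S : Finset (IrrPoly Fq), ∏ P ∈ S, fterm n α P.1.natDegree v
  have h2 : HasSum (hterm n α v ∘ prodS) a := hasSum_of_eq h1.hasSum fun S => (prod_fterm n v S).symm
  rw [prodS_injective.hasSum_iff] at h2
  · have h3 := ((Equiv.sigmaFiberEquiv (fun D : MonPoly Fq => D.1.natDegree)).hasSum_iff.2 h2)
    have h4 := h3.sigma (g := fun m : ℕ => if α ∣ m then (bb Fq n α (m / α) : ℂ) * v ^ (m / α)
      else 0) ?_
    · have hinj : Function.Injective (fun m : ℕ => α * m) := fun x y h =>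
        Nat.eq_of_mul_eq_mul_left hα h
      rw [← hinj.hasSum_iff] at h4
      · refine hasSum_of_eq h4 fun m => ?_
        simp [Nat.mul_div_cancel_left _ hα]
      · intro m hm
        rw [if_neg]
        rintro ⟨c, rfl⟩
        exact hm ⟨c, rfl⟩
    · intro m
      change HasSum (fun y : {D : MonPoly Fq // D.1.natDegree = m} => hterm n α v y.1) _
      split_ifs with h
      · obtain ⟨c, rfl⟩ := h
        rw [Nat.mul_div_cancel_left _ hα]
        exact fiber_hasSum Fq n hα v c
      · refine hasSum_of_eq hasSum_zero fun y => ?_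
        rw [hterm, if_neg]
        intro hg
        exact h (y.2 ▸ goodD_dvd α y.1 hg)
  · intro D hD
    rw [hterm, if_neg]
    intro hg
    exact hD (prodS_surj _ D rfl hg.1)


lemma poly_summable (R : ℝ[X]) {s : ℝ} (hs0 : 0 ≤ s) (hs : s < 1) :
    Summable (fun i : ℕ => |R.eval (-(i:ℝ))| * s ^ i) := by
  induction R using Polynomial.induction_on' with
  | add p q hp hq =>
    refine Summable.of_nonneg_of_le (fun i => by positivity) (fun i => ?_) (hp.add hq)
    rw [eval_add, ← add_mul]
    gcongr
    exact abs_add_le _ _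
  | monomial n c =>
    have h := (summable_pow_mul_geometric_of_norm_lt_one (R := ℝ) n (r := s)
      (by rwa [Real.norm_of_nonneg hs0])).mul_left |c|
    refine h.congr fun i => ?_
    rw [eval_monomial, abs_mul, abs_pow, abs_neg, Nat.abs_cast, mul_assoc]

def binPoly (k : ℕ) : ℝ[X] := C (1 / (k.factorial : ℝ)) * (ascPochhammer ℝ k).comp (X + 1)

lemma binPoly_eval (k j : ℕ) : (binPoly k).eval (j : ℝ) = ((j + k).choose k : ℝ) := by
  have h1 : (ascPochhammer ℝ k).eval ((j : ℝ) + 1) = (k.factorial : ℝ) * ((j + k).choose k : ℝ) := by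
    have := ascPochhammer_nat_eq_ascFactorial (j + 1) k
    rw [Nat.ascFactorial_eq_factorial_mul_choose] at this
    have h2 := ascPochhammer_eval_cast (S := ℝ) k (j + 1)
    rw [this] at h2
    push_cast at h2
    exact h2.symm
  rw [binPoly]
  simp only [eval_mul, eval_C, eval_comp, eval_add, eval_X, eval_one, h1]
  field_simp

lemma binPoly_natDegree (k : ℕ) : (binPoly k).natDegree = k := by
  rw [binPoly, natDegree_C_mul (by positivity), natDegree_comp, ascPochhammer_natDegree]
  rw [show (X + 1 : ℝ[X]) = X + C 1 by simp, natDegree_X_add_C, mul_one]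

lemma binPoly_leadingCoeff (k : ℕ) : (binPoly k).leadingCoeff = 1 / (k.factorial : ℝ) := by
  rw [binPoly, leadingCoeff_mul, leadingCoeff_C]
  have : ((ascPochhammer ℝ k).comp (X + 1)).Monic := by
    rw [show (X + 1 : ℝ[X]) = X + C 1 by simp]
    exact (monic_ascPochhammer ℝ k).comp (monic_X_add_C 1) (by rw [natDegree_X_add_C]; simp)
  rw [this.leadingCoeff, mul_one]

lemma asymp (B : ℝ) (hB : 1 < B) (k : ℕ) (a b : ℕ → ℝ)
    (ha : ∀ T, √B < T → ∃ C : ℝ, 0 ≤ C ∧ ∀ i, |a i| ≤ C * T ^ i)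
    (hb : ∀ n, b n = ∑ ij ∈ Finset.HasAntidiagonal.antidiagonal n,
      a ij.1 * (((ij.2 + k).choose k : ℝ) * B ^ ij.2)) :
    ∃ Q : ℝ[X], Q.natDegree ≤ k ∧ Q.coeff k = (∑' i, a i * (1 / B) ^ i) / (k.factorial : ℝ) ∧
      ∀ T, √B < T → T < B → ∃ C : ℝ, ∀ n : ℕ, |b n - B ^ n * Q.eval (n : ℝ)| ≤ C * T ^ n := by
  have hB0 : 0 < B := by linarith
  set p := binPoly k with hp
  have hsqrt : √B < B := by
    rw [Real.sqrt_lt' hB0]; nlinarith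
  have hsum' : ∀ R : ℝ[X], Summable (fun i : ℕ => a i / B ^ i * R.eval (-(i:ℝ))) := by
    intro R
    obtain ⟨T, hT1, hT2⟩ := exists_between hsqrt
    obtain ⟨C, hC, h⟩ := ha T hT1
    have hT0 : 0 < T := (Real.sqrt_nonneg B).trans_lt hT1
    have hs := (poly_summable R (s := T / B) (by positivity) ((div_lt_one hB0).2 hT2)).mul_left C
    refine Summable.of_norm_bounded hs fun i => ?_
    rw [Real.norm_eq_abs, abs_mul, abs_div, abs_of_pos (pow_pos hB0 i), div_pow]
    calc _ ≤ (C * T ^ i) / B ^ i * |R.eval (-(i:ℝ))| := by gcongr; exact h i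
      _ = _ := by ring
  let Q : ℝ[X] := ∑ j ∈ Finset.range (k + 1),
    C (∑' i : ℕ, a i / B ^ i * (hasseDeriv j p).eval (-(i:ℝ))) * X ^ j
  have hQc : ∀ m, Q.coeff m = if m < k + 1 then
      (∑' i : ℕ, a i / B ^ i * (hasseDeriv m p).eval (-(i:ℝ))) else 0 := by
    intro m
    simp [Q, finsetSum_coeff, coeff_C_mul, coeff_X_pow]
  have hpe : ∀ x y : ℝ, p.eval (x + y) =
      ∑ j ∈ Finset.range (k + 1), (hasseDeriv j p).eval y * x ^ j := by
    intro x y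
    rw [← taylor_eval, eval_eq_sum_range, natDegree_taylor, hp, binPoly_natDegree]
    simp [taylor_coeff]
  have hQe : ∀ x : ℝ, HasSum (fun i : ℕ => a i / B ^ i * p.eval (x - i)) (Q.eval x) := by
    intro x
    have h1 := hasSum_sum (s := Finset.range (k + 1))
      (f := fun j (i : ℕ) => a i / B ^ i * (hasseDeriv j p).eval (-(i:ℝ)) * x ^ j)
      (fun j _ => (hsum' (hasseDeriv j p)).hasSum.mul_right (x ^ j))
    have e1 : Q.eval x = ∑ j ∈ Finset.range (k + 1),
      (∑' i : ℕ, a i / B ^ i * (hasseDeriv j p).eval (-(i:ℝ))) * x ^ j := by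
      simp [Q, eval_finsetSum]
    rw [e1]
    have e2 : (fun i : ℕ => a i / B ^ i * p.eval (x - i)) = fun i : ℕ =>
      ∑ j ∈ Finset.range (k + 1), a i / B ^ i * (hasseDeriv j p).eval (-(i:ℝ)) * x ^ j := by
      funext i
      rw [sub_eq_add_neg, hpe, Finset.mul_sum]
      exact Finset.sum_congr rfl fun j _ => by ring
    rw [e2]
    exact h1
  refine ⟨Q, ?_, ?_, ?_⟩
  · rw [natDegree_le_iff_coeff_eq_zero]
    intro m hm
    rw [hQc, if_neg (by omega)]
  · rw [hQc, if_pos (by omega)]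
    have hd : hasseDeriv k p = C (1 / (k.factorial : ℝ)) := by
      have := hasseDeriv_natDegree_eq_C p
      rwa [hp, binPoly_natDegree, binPoly_leadingCoeff] at this
    rw [hd, ← tsum_div_const]
    simp only [eval_C]
    refine tsum_congr fun i => ?_
    rw [one_div_pow]; ring
  · intro T hT1 hT2
    obtain ⟨C, hC, h⟩ := ha T hT1
    have hT0 : 0 < T := (Real.sqrt_nonneg B).trans_lt hT1
    have hs := ((poly_summable p (s := T / B) (by positivity)
      ((div_lt_one hB0).2 hT2)).mul_left C)
    have hs1 := (summable_nat_add_iff 1).2 hs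
    refine ⟨∑' i : ℕ, C * (|p.eval (-((i + 1 : ℕ):ℝ))| * (T / B) ^ (i + 1)), fun n => ?_⟩
    have hn := (hQe n).mul_left (B ^ n)
    have hsplit := hn.summable.sum_add_tsum_nat_add (n + 1)
    rw [hn.tsum_eq] at hsplit
    have hbn : b n = ∑ i ∈ Finset.range (n + 1), B ^ n * (a i / B ^ i * p.eval ((n:ℝ) - i)) := by
      rw [hb, Finset.Nat.sum_antidiagonal_eq_sum_range_succ_mk]
      refine Finset.sum_congr rfl fun i hi => ?_
      have hi' : i ≤ n := by simp at hi; omega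
      rw [← Nat.cast_sub hi', hp, binPoly_eval]
      rw [pow_sub₀ _ hB0.ne' hi']
      simp only
      ring
    rw [← hsplit, hbn]
    rw [sub_add_cancel_left, abs_neg, ← tsum_mul_right, ← Real.norm_eq_abs]
    refine tsum_of_norm_bounded (hs1.mul_right (T ^ n)).hasSum fun i => ?_
    have e : ((n:ℝ) - ((i + (n + 1) : ℕ) : ℝ)) = -((i + 1 : ℕ) : ℝ) := by push_cast; ring
    rw [e, Real.norm_eq_abs, abs_mul, abs_mul, abs_div, abs_of_pos (pow_pos hB0 _),
      abs_of_pos (pow_pos hB0 _)]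
    calc _ ≤ B ^ n * ((C * T ^ (i + (n + 1))) / B ^ (i + (n + 1)) *
            |p.eval (-((i + 1 : ℕ) : ℝ))|) := by gcongr; exact h _
      _ = _ := by
        rw [div_pow]
        field_simp
        ring

lemma coeff_unique (a c : ℕ → ℂ) (H : ℂ → ℂ) (r : ℝ) (hr : 0 < r)
    (ha : ∀ v, ‖v‖ < r → HasSum (fun n => a n * v ^ n) (H v))
    (hc : ∀ v, ‖v‖ < r → HasSum (fun n => c n * v ^ n) (H v)) : a = c := by
  have key : ∀ a : ℕ → ℂ, (∀ v, ‖v‖ < r → HasSum (fun n => a n * v ^ n) (H v)) →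
      HasFPowerSeriesAt H (FormalMultilinearSeries.ofScalars ℂ a) 0 := by
    intro a ha
    rw [hasFPowerSeriesAt_iff]
    filter_upwards [Metric.ball_mem_nhds (0:ℂ) hr] with v hv
    have := ha v (by simpa using hv)
    simpa [FormalMultilinearSeries.coeff_ofScalars, mul_comm] using this
  have := (key a ha).eq_formalMultilinearSeries (key c hc)
  funext n
  have h := congrArg (fun p => FormalMultilinearSeries.coeff p n) this
  simpa [FormalMultilinearSeries.coeff_ofScalars] using h


lemma exists_root_y {q : ℝ} (hq : 0 < q) {α : ℕ} (hα : 0 < α) {t : ℝ} (ht : 0 < t)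
    (h : q ^ α * t ^ 2 < 1) : ∃ y : ℝ, 0 < y ∧ y ^ α = t ∧ q * y ^ 2 < 1 := by
  refine ⟨t ^ ((α:ℝ)⁻¹), by positivity, Real.rpow_inv_natCast_pow ht.le hα.ne', ?_⟩
  set y := t ^ ((α:ℝ)⁻¹) with hy
  have hyα : y ^ α = t := Real.rpow_inv_natCast_pow ht.le hα.ne'
  have h2 : (q * y ^ 2) ^ α < 1 := by
    rw [mul_pow, ← pow_mul, mul_comm 2, pow_mul, hyα]; exact h
  by_contra! h3
  exact absurd h2 (not_lt.2 (one_le_pow₀ h3))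

def gc (Fq : Type*) [Field Fq] (w α k : ℕ) : ℂ :=
  (k.factorial : ℂ)⁻¹ * iteratedDeriv k (bigG Fq w α) 0

lemma exists_bigger {B x : ℝ} (hB : 0 < B) (hx : 0 ≤ x) (h : B * x ^ 2 < 1) :
    ∃ t, x < t ∧ B * t ^ 2 < 1 := by
  have hc : Tendsto (fun t : ℝ => B * t ^ 2) (𝓝[>] x) (𝓝 (B * x ^ 2)) :=
    ((continuous_const.mul (continuous_pow 2)).tendsto x).mono_left nhdsWithin_le_nhds
  obtain ⟨t, ht1, ht2⟩ := ((hc.eventually (gt_mem_nhds h)).and self_mem_nhdsWithin).exists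
  exact ⟨t, ht2, ht1⟩

lemma bigG_region (Fq : Type*) [Field Fq] [Fintype Fq] (w : ℕ) {α : ℕ} (hα : 0 < α) (v : ℂ)
    (hv : (Fintype.card Fq : ℝ) ^ α * ‖v‖ ^ 2 < 1) :
    ∃ R : ℝ, ‖v‖ < R ∧ DifferentiableOn ℂ (bigG Fq w α) (Metric.ball 0 R) := by
  have hq : (0:ℝ) < Fintype.card Fq := by exact_mod_cast Fintype.card_pos
  obtain ⟨t, ht1, ht2⟩ := exists_bigger (pow_pos hq α) (norm_nonneg v) hv
  obtain ⟨y, hy0, hyt, hy⟩ := exists_root_y hq hα ((norm_nonneg v).trans_lt ht1) ht2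
  exact ⟨t, ht1, hyt ▸ bigG_diff Fq w hα hy0 hy⟩

lemma bigG_hasSum (Fq : Type*) [Field Fq] [Fintype Fq] (w : ℕ) {α : ℕ} (hα : 0 < α) (v : ℂ)
    (hv : (Fintype.card Fq : ℝ) ^ α * ‖v‖ ^ 2 < 1) :
    HasSum (fun k => gc Fq w α k * v ^ k) (bigG Fq w α v) := by
  obtain ⟨R, hR, hd⟩ := bigG_region Fq w hα v hv
  have h := Complex.hasSum_taylorSeries_on_ball hd (z := v) (by simpa using hR)
  refine hasSum_of_eq h fun k => ?_
  rw [gc, sub_zero, smul_eq_mul, smul_eq_mul]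
  ring

lemma bigG_cont (Fq : Type*) [Field Fq] [Fintype Fq] (w : ℕ) {α : ℕ} (hα : 0 < α) (v : ℂ)
    (hv : (Fintype.card Fq : ℝ) ^ α * ‖v‖ ^ 2 < 1) :
    ContinuousAt (bigG Fq w α) v := by
  obtain ⟨R, hR, hd⟩ := bigG_region Fq w hα v hv
  exact hd.continuousOn.continuousAt (Metric.isOpen_ball.mem_nhds (by simpa using hR))

lemma gc_bound (Fq : Type*) [Field Fq] [Fintype Fq] (w : ℕ) {α : ℕ} (hα : 0 < α) (T : ℝ)
    (hT : √((Fintype.card Fq : ℝ) ^ α) < T) :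
    ∃ C : ℝ, 0 ≤ C ∧ ∀ i, |(gc Fq w α i).re| ≤ C * T ^ i := by
  have hT0 : 0 < T := (Real.sqrt_nonneg _).trans_lt hT
  have h1 : (Fintype.card Fq : ℝ) ^ α < T ^ 2 := (Real.sqrt_lt' hT0).1 hT
  have hs := (bigG_hasSum Fq w hα ((1 / T : ℝ) : ℂ) (by
    rw [Complex.norm_real, Real.norm_of_nonneg (by positivity), one_div_pow, mul_one_div]
    exact (div_lt_one (by positivity)).2 h1)).summable.norm
  refine ⟨∑' k, ‖gc Fq w α k * ((1 / T : ℝ) : ℂ) ^ k‖, tsum_nonneg fun _ => norm_nonneg _,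
    fun i => ?_⟩
  have h2 := hs.le_tsum i (fun _ _ => norm_nonneg _)
  rw [norm_mul, norm_pow, Complex.norm_real, Real.norm_of_nonneg (by positivity), one_div_pow,
    mul_one_div, div_le_iff₀ (by positivity)] at h2
  exact (Complex.abs_re_le_norm _).trans h2

lemma bb_conv (Fq : Type*) [Field Fq] [Fintype Fq] (k : ℕ) {α : ℕ} (hα : 0 < α) (n : ℕ) :
    bb Fq (α * (k + 1)) α n = ∑ ij ∈ Finset.HasAntidiagonal.antidiagonal n,
      (gc Fq (k + 1) α ij.1).re * (((ij.2 + k).choose k : ℝ) *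
        ((Fintype.card Fq : ℝ) ^ α) ^ ij.2) := by
  have hq : (1:ℝ) ≤ Fintype.card Fq := by exact_mod_cast Fintype.card_pos
  have hB : (1:ℝ) ≤ (Fintype.card Fq : ℝ) ^ α := one_le_pow₀ hq
  set B : ℝ := (Fintype.card Fq : ℝ) ^ α with hBdef
  have hB0 : 0 < B := by linarith
  have hBc : (B : ℂ) = (Fintype.card Fq : ℂ) ^ α := by rw [hBdef]; push_cast; rfl
  have key := coeff_unique (fun n => (bb Fq (α * (k + 1)) α n : ℂ))
    (fun n => ∑ ij ∈ Finset.HasAntidiagonal.antidiagonal n,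
      gc Fq (k + 1) α ij.1 * (((ij.2 + k).choose k : ℂ) * (B : ℂ) ^ ij.2))
    (fun v => ∏' P : IrrPoly Fq, (1 + fterm (α * (k + 1)) α P.1.natDegree v)) (1 / B)
    (by positivity) (fun v hv => hasSum_bb Fq _ hα v (by
      rw [lt_div_iff₀ hB0] at hv; rw [← hBdef]; linarith)) ?_
  · have h := congrArg Complex.re (congrFun key n)
    simp only [Complex.ofReal_re, Complex.re_sum] at h
    rw [h]
    refine Finset.sum_congr rfl fun ij _ => ?_
    rw [← Complex.re_mul_ofReal]
    push_cast
    rfl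
  · intro v hv
    have hv1 : B * ‖v‖ < 1 := by rw [lt_div_iff₀ hB0] at hv; linarith
    have hv2 : B * ‖v‖ ^ 2 < 1 := by nlinarith [norm_nonneg v]
    have hne : (1 - (B : ℂ) * v) ≠ 0 := by
      intro h
      have h2 : ‖(B : ℂ) * v‖ = 1 := by
        rw [← sub_eq_zero.1 h]; simp
      rw [norm_mul, Complex.norm_real, Real.norm_of_nonneg hB0.le] at h2
      linarith
    have hG := bigG_hasSum Fq (k + 1) hα v hv2
    have hbin := hasSum_choose_mul_geometric_of_norm_lt_one (𝕜 := ℂ) k (r := (B : ℂ) * v) (by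
      rwa [norm_mul, Complex.norm_real, Real.norm_of_nonneg hB0.le])
    have hGe := bigG_eq Fq (k + 1) hα v hv1
    have hF : (∏' P : IrrPoly Fq, (1 + fterm (α * (k + 1)) α P.1.natDegree v)) =
        bigG Fq (k + 1) α v * (1 / (1 - (B : ℂ) * v) ^ (k + 1)) := by
      rw [hGe, ← hBc]
      field_simp
    have hsm := (summable_norm_sum_mul_antidiagonal_of_summable_norm hG.summable.norm
      hbin.summable.norm).of_norm
    have ht := tsum_mul_tsum_eq_tsum_sum_antidiagonal_of_summable_norm hG.summable.norm
      hbin.summable.norm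
    rw [hG.tsum_eq, hbin.tsum_eq] at ht
    simp only [hF]
    rw [ht]
    refine hasSum_of_eq hsm.hasSum fun m => ?_
    rw [Finset.sum_mul]
    refine Finset.sum_congr rfl fun ij hij => ?_
    rw [← (Finset.HasAntidiagonal.mem_antidiagonal.1 hij), pow_add, mul_pow]
    ring

lemma tprod_conv (Fq : Type*) [Field Fq] [Fintype Fq] (n : ℕ) {α : ℕ} (hα : 0 < α) (s : ℝ)
    (hs : 1 < s) :
    ((∏' P : {P : Polynomial Fq // P.Monic ∧ Irreducible P ∧ α ∣ P.natDegree},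
          (1 + (n : ℝ) * (Fintype.card Fq : ℝ) ^ (-(P.1.natDegree : ℝ) * s)) : ℝ) : ℂ) =
    ∏' P : IrrPoly Fq, (1 + fterm n α P.1.natDegree
      (((((Fintype.card Fq : ℝ) ^ α) ^ (-s) : ℝ)) : ℂ)) := by
  have hq : (1:ℝ) < Fintype.card Fq := by exact_mod_cast Fintype.one_lt_card
  have hq0 : (0:ℝ) < Fintype.card Fq := by linarith
  set q : ℝ := (Fintype.card Fq : ℝ) with hqdef
  have hB : 1 < q ^ α := one_lt_pow₀ hq hα.ne'
  have hB0 : 0 < q ^ α := by positivity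
  set x : ℝ := (q ^ α) ^ (-s) with hx
  have hx0 : 0 < x := by positivity
  have hx1 : q ^ α * x < 1 := by
    rw [hx]
    calc q ^ α * (q ^ α) ^ (-s) = (q ^ α) ^ (1 - s) := by
          rw [sub_eq_add_neg, Real.rpow_add hB0, Real.rpow_one]
      _ < 1 := Real.rpow_lt_one_of_one_lt_of_neg hB (by linarith)
  let rt : IrrPoly Fq → ℝ := fun P => if α ∣ P.1.natDegree then n * x ^ kk α P.1.natDegree else 0
  have hrt : ∀ P : IrrPoly Fq, ((rt P : ℝ) : ℂ) = fterm n α P.1.natDegree (x : ℂ) := by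
    intro P
    simp only [rt, fterm]
    split_ifs <;> simp
  have hsum := fterm_summable Fq n hα (x : ℂ) (by
    rw [Complex.norm_real, Real.norm_of_nonneg hx0.le]; exact hx1)
  have hsum2 : Summable rt := by
    apply Summable.of_norm
    refine hsum.congr fun P => ?_
    rw [← hrt, Complex.norm_real]
  have hm := Real.multipliable_one_add_of_summable hsum2
  let i : {P : Polynomial Fq // P.Monic ∧ Irreducible P ∧ α ∣ P.natDegree} → IrrPoly Fq :=
    fun P => ⟨P.1, P.2.1, P.2.2.1⟩
  have hi : Function.Injective i := fun a b h => Subtype.ext (congrArg (fun z : IrrPoly Fq => z.1) h)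
  have e1 : (∏' P : {P : Polynomial Fq // P.Monic ∧ Irreducible P ∧ α ∣ P.natDegree},
          (1 + (n : ℝ) * q ^ (-(P.1.natDegree : ℝ) * s))) = ∏' P : IrrPoly Fq, (1 + rt P) := by
    rw [← hi.tprod_eq]
    · refine tprod_congr fun P => ?_
      have hd : α ∣ (i P).1.natDegree := P.2.2.2
      simp only [rt, if_pos hd]
      rw [kk, Nat.gcd_eq_left hd, hx, ← Real.rpow_natCast, ← Real.rpow_natCast, ← Real.rpow_mul hq0.le,
        ← Real.rpow_mul hq0.le]
      congr 3
      have h3 : ((α * ((i P).1.natDegree / α) : ℕ) : ℝ) = (P.1.natDegree : ℝ) := by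
        rw [Nat.mul_div_cancel' hd]
      rw [← h3]
      push_cast
      ring
    · intro P hP
      by_contra h
      apply hP
      have : ¬ α ∣ P.1.natDegree := fun hd => h ⟨⟨P.1, P.2.1, P.2.2, hd⟩, rfl⟩
      simp [rt, this]
  rw [e1]
  have h5 := hm.map_tprod Complex.ofRealHom Complex.continuous_ofReal
  change Complex.ofRealHom _ = _
  rw [h5]
  refine tprod_congr fun P => ?_
  rw [← hrt]
  simp

lemma slope_lim {B : ℝ} (hB : 1 < B) :
    Tendsto (fun s : ℝ => (s - 1) / (1 - B * B ^ (-s))) (𝓝[>] 1) (𝓝 (1 / Real.log B)) := by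
  have hB0 : 0 < B := by linarith
  have hd : HasDerivAt (fun s : ℝ => 1 - B ^ (1 - s)) (Real.log B) 1 := by
    have h1 : HasDerivAt (fun s : ℝ => 1 - s) (-1) 1 := by
      simpa using (hasDerivAt_id (1:ℝ)).const_sub 1
    have := (h1.const_rpow hB0).const_sub 1
    simpa using this
  have h2 := hd.tendsto_slope.mono_left
    (nhdsWithin_mono (1:ℝ) (fun x (hx : 1 < x) => hx.ne'))
  have h3 := h2.inv₀ (Real.log_pos hB).ne'
  rw [one_div]
  refine h3.congr' ?_
  filter_upwards [self_mem_nhdsWithin] with s hs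
  rw [slope_def_field]
  simp only [sub_self, Real.rpow_zero, sub_zero, inv_div]
  rw [sub_eq_add_neg 1 s, Real.rpow_add hB0, Real.rpow_one]

lemma limit_value (Fq : Type*) [Field Fq] [Fintype Fq] (w : ℕ) {α : ℕ} (hα : 0 < α) (r : ℝ)
    (hr : Tendsto (fun s : ℝ => (s - 1) ^ w *
        ∏' P : {P : Polynomial Fq // P.Monic ∧ Irreducible P ∧ α ∣ P.natDegree},
          (1 + ((α * w : ℕ) : ℝ) * (Fintype.card Fq : ℝ) ^ (-(P.1.natDegree : ℝ) * s)))
      (𝓝[>] (1 : ℝ)) (𝓝 r)) :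
    bigG Fq w α ((1 / (Fintype.card Fq : ℝ) ^ α : ℝ) : ℂ) =
      ((r * Real.log ((Fintype.card Fq : ℝ) ^ α) ^ w : ℝ) : ℂ) := by
  have hq : (1:ℝ) < Fintype.card Fq := by exact_mod_cast Fintype.one_lt_card
  have hB : 1 < (Fintype.card Fq : ℝ) ^ α := one_lt_pow₀ hq hα.ne'
  set B : ℝ := (Fintype.card Fq : ℝ) ^ α with hBdef
  have hB0 : 0 < B := by linarith
  have hBc : (B : ℂ) = (Fintype.card Fq : ℂ) ^ α := by rw [hBdef]; push_cast; rfl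
  have hr' := (Complex.continuous_ofReal.tendsto r).comp hr
  have h1 : Tendsto (fun s : ℝ => ((((s - 1) / (1 - B * B ^ (-s)) : ℝ) : ℂ)) ^ w *
      bigG Fq w α ((B ^ (-s) : ℝ) : ℂ)) (𝓝[>] 1)
      (𝓝 (((1 / Real.log B : ℝ) : ℂ) ^ w * bigG Fq w α ((1 / B : ℝ) : ℂ))) := by
    refine Tendsto.mul ?_ ?_
    · exact ((Complex.continuous_ofReal.tendsto _).comp (slope_lim hB)).pow w
    · have hc := bigG_cont Fq w hα ((1 / B : ℝ) : ℂ) (by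
        rw [← hBdef, Complex.norm_real, Real.norm_of_nonneg (by positivity)]
        field_simp
        exact hB)
      refine hc.tendsto.comp ((Complex.continuous_ofReal.tendsto _).comp ?_)
      have : ContinuousAt (fun s : ℝ => B ^ (-s)) 1 :=
        (Real.continuousAt_const_rpow hB0.ne').comp continuous_neg.continuousAt
      have h2 := this.tendsto.mono_left (nhdsWithin_le_nhds (s := Set.Ioi 1))
      simpa [Real.rpow_neg_one, one_div] using h2
  have h2 : (r : ℂ) = ((1 / Real.log B : ℝ) : ℂ) ^ w * bigG Fq w α ((1 / B : ℝ) : ℂ) := by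
    refine tendsto_nhds_unique hr' (h1.congr' ?_)
    filter_upwards [self_mem_nhdsWithin] with s hs
    have hs' : 1 < s := hs
    have hx1 : B * B ^ (-s) < 1 := by
      calc B * B ^ (-s) = B ^ (1 - s) := by
            rw [sub_eq_add_neg, Real.rpow_add hB0, Real.rpow_one]
        _ < 1 := Real.rpow_lt_one_of_one_lt_of_neg hB (by linarith)
    have hx0 : 0 < B ^ (-s) := by positivity
    rw [bigG_eq Fq w hα _ (by
      rw [← hBdef, Complex.norm_real, Real.norm_of_nonneg hx0.le]; exact hx1), ← hBc]
    simp only [Function.comp]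
    rw [Complex.ofReal_mul, tprod_conv Fq (α * w) hα s hs', ← hBdef]
    have hne : (1 - (B : ℂ) * ((B ^ (-s) : ℝ) : ℂ)) ≠ 0 := by
      have : (1 - B * B ^ (-s)) ≠ 0 := by linarith
      exact_mod_cast this
    rw [Complex.ofReal_div, div_pow, Complex.ofReal_sub 1 (B * _), Complex.ofReal_mul B,
      Complex.ofReal_one, Complex.ofReal_pow (s - 1) w, Complex.ofReal_sub s 1, Complex.ofReal_one]
    generalize (∏' P : IrrPoly Fq, _ : ℂ) = F
    rw [div_mul_eq_mul_div, div_eq_iff (pow_ne_zero _ hne)]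
    ring
  have hl : ((Real.log B : ℝ) : ℂ) ≠ 0 := by exact_mod_cast (Real.log_pos hB).ne'
  rw [Complex.ofReal_mul, h2, Complex.ofReal_pow (Real.log B) w,
    Complex.ofReal_div 1 (Real.log B)]
  generalize bigG Fq w α ((1 / B : ℝ) : ℂ) = g
  rw [Complex.ofReal_one, mul_right_comm, ← mul_pow, one_div_mul_cancel hl, one_pow, one_mul]

theorem stmt1 (Fq : Type*) [Field Fq] [Fintype Fq] (q ℓ α w : ℕ)
    (hq : Fintype.card Fq = q) (hℓ : ℓ.Prime) (hℓq : ¬ ℓ ∣ q)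
    (hα : α = orderOf (q : ZMod ℓ)) (hw : α * w = ℓ - 1)
    (r : ℝ)
    (hr : Tendsto (fun s : ℝ => (s - 1) ^ w *
        ∏' P : {P : Polynomial Fq // P.Monic ∧ Irreducible P ∧ α ∣ P.natDegree},
          (1 + ((ℓ : ℝ) - 1) * (q : ℝ) ^ (-(P.1.natDegree : ℝ) * s)))
      (𝓝[>] (1 : ℝ)) (𝓝 r)) :
    ∃ Q : Polynomial ℝ, Q.natDegree = w - 1 ∧
      Q.leadingCoeff = r * (Real.log ((q : ℝ) ^ α)) ^ w / ((w - 1).factorial : ℝ) ∧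
      ∀ ε > (0 : ℝ),
        (fun n : ℕ =>
            (∑ᶠ D ∈ {D : Polynomial Fq | D.Monic ∧ Squarefree D ∧ D.natDegree = α * n ∧
                ∀ P : Polynomial Fq, P.Monic → Irreducible P → P ∣ D → α ∣ P.natDegree},
              ((ℓ : ℝ) - 1) ^ omegaCount Fq D) -
            (q : ℝ) ^ (α * n) * Q.eval (n : ℝ))
          =O[atTop] (fun n : ℕ => (q : ℝ) ^ (((α : ℝ) / 2 + ε) * (n : ℝ))) := by
  clear hα hℓq
  subst hq
  have hℓ2 := hℓ.two_le
  have hα0 : 0 < α := Nat.pos_of_ne_zero (by rintro rfl; simp at hw; omega)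
  have hw0 : w ≠ 0 := by rintro rfl; simp at hw; omega
  have hn : (ℓ : ℝ) - 1 = ((α * w : ℕ) : ℝ) := by
    rw [hw, Nat.cast_sub (by omega), Nat.cast_one]
  rw [hn] at hr
  simp only [hn]
  obtain ⟨k, rfl⟩ := Nat.exists_eq_succ_of_ne_zero hw0
  simp only [Nat.succ_eq_add_one, Nat.add_sub_cancel] at *
  have hval := limit_value Fq (k + 1) hα0 r hr
  have hq : (1:ℝ) < Fintype.card Fq := by exact_mod_cast Fintype.one_lt_card
  have hq0 : (0:ℝ) < Fintype.card Fq := by linarith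
  have hB : 1 < (Fintype.card Fq : ℝ) ^ α := one_lt_pow₀ hq hα0.ne'
  have hB0 : 0 < (Fintype.card Fq : ℝ) ^ α := by linarith
  obtain ⟨Q, hQ1, hQ2, hQ3⟩ := asymp ((Fintype.card Fq : ℝ) ^ α) hB k
    (fun i => (gc Fq (k + 1) α i).re) (fun n => bb Fq (α * (k + 1)) α n)
    (gc_bound Fq (k + 1) hα0) (bb_conv Fq k hα0)
  have hsum : (∑' i, (gc Fq (k + 1) α i).re * (1 / (Fintype.card Fq : ℝ) ^ α) ^ i) =
      r * Real.log ((Fintype.card Fq : ℝ) ^ α) ^ (k + 1) := by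
    have h1 := bigG_hasSum Fq (k + 1) hα0 ((1 / (Fintype.card Fq : ℝ) ^ α : ℝ) : ℂ) (by
        rw [Complex.norm_real, Real.norm_of_nonneg (by positivity)]
        field_simp
        exact hB)
    rw [hval] at h1
    have h2 := Complex.hasSum_re h1
    rw [Complex.ofReal_re] at h2
    rw [← h2.tsum_eq]
    refine tsum_congr fun i => ?_
    rw [← Complex.re_mul_ofReal]
    push_cast
    rfl
  have hne : r * Real.log ((Fintype.card Fq : ℝ) ^ α) ^ (k + 1) ≠ 0 := by
    intro h0
    rw [h0] at hval
    refine bigG_ne_zero Fq (k + 1) hα0 (y := 1 / Fintype.card Fq) (by positivity) (by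
      field_simp; exact hq) ?_
    rw [one_div_pow, hval, Complex.ofReal_zero]
  rw [hsum] at hQ2
  have hdeg : Q.natDegree = k := by
    apply le_antisymm hQ1
    apply le_natDegree_of_ne_zero
    rw [hQ2]
    exact div_ne_zero hne (by positivity)
  refine ⟨Q, hdeg, ?_, ?_⟩
  · rw [leadingCoeff, hdeg, hQ2]
  · intro ε hε
    set e := min ε ((α : ℝ) / 4) with he
    have hαR : (0:ℝ) < α := by exact_mod_cast hα0
    have he0 : 0 < e := lt_min hε (by positivity)
    have he1 : e ≤ ε := min_le_left _ _
    have he2 : e ≤ (α : ℝ) / 4 := min_le_right _ _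
    obtain ⟨C, hC⟩ := hQ3 ((Fintype.card Fq : ℝ) ^ ((α : ℝ) / 2 + e)) (by
      rw [Real.sqrt_eq_rpow, ← Real.rpow_natCast, ← Real.rpow_mul hq0.le]
      apply Real.rpow_lt_rpow_of_exponent_lt hq
      linarith) (by
      rw [← Real.rpow_natCast]
      apply Real.rpow_lt_rpow_of_exponent_lt hq
      linarith)
    refine IsBigO.of_bound |C| (Eventually.of_forall fun n => ?_)
    have h1 := hC n
    rw [← pow_mul] at h1
    rw [Real.norm_eq_abs, Real.norm_of_nonneg (by positivity)]
    refine h1.trans ?_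
    rw [← Real.rpow_natCast, ← Real.rpow_mul hq0.le]
    gcongr
    · exact le_abs_self C
    · exact hq.le
end
end

section
/- For every real s > 1 one has the factorization f(s) = (1 − q^{α(1−s)})^{−w} · g(s), where g(s) = h(s) · ∏_{d ∣ α, d ≠ α} L_d(s)^{−w}, with h(s) = ∏_{P : α ∣ deg(P)} (1 + (ℓ−1)·q^{−deg(P)s})·(1 − q^{−deg(P)s})^{ℓ−1} and L_d(s) = ∏_{P : gcd(α, deg(P)) = d} (1 − q^{−α·deg(P)·s/d})^{−d}. Moreover the infinite product defining h(s) converges (is multipliable) for every real s > 1/2, each product L_d(s) with d ∣ α, d ≠ α converges for every real s > 1/2, and g(1) > 0. -/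
open Polynomial Filter Asymptotics Topology

noncomputable section

/-- `h(s) = ∏_{α ∣ deg P} (1 + (ℓ−1)q^{−deg(P)s})(1 − q^{−deg(P)s})^{ℓ−1}`. -/
noncomputable def hFun (Fq : Type*) [Field Fq] [Fintype Fq] (q ℓ α : ℕ) (s : ℝ) : ℝ :=
  ∏' P : {P : Polynomial Fq // P.Monic ∧ Irreducible P ∧ α ∣ P.natDegree},
    (1 + ((ℓ : ℝ) - 1) * (q : ℝ) ^ (-(P.1.natDegree : ℝ) * s)) *
      (1 - (q : ℝ) ^ (-(P.1.natDegree : ℝ) * s)) ^ (ℓ - 1)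

/-- `L_d(s) = ∏_{gcd(α, deg P) = d} (1 − q^{−α·deg(P)·s/d})^{−d}`. -/
noncomputable def LFun (Fq : Type*) [Field Fq] [Fintype Fq] (q α d : ℕ) (s : ℝ) : ℝ :=
  ∏' P : {P : Polynomial Fq // P.Monic ∧ Irreducible P ∧ Nat.gcd α P.natDegree = d},
    ((1 - (q : ℝ) ^ (-((α / d * P.1.natDegree : ℕ) : ℝ) * s)) ^ d)⁻¹

/-- `g(s) = h(s) · ∏_{d ∣ α, d ≠ α} L_d(s)^{−w}`. -/
noncomputable def gFun (Fq : Type*) [Field Fq] [Fintype Fq] (q ℓ α w : ℕ) (s : ℝ) : ℝ :=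
  hFun Fq q ℓ α s * ∏ d ∈ α.divisors.erase α, (LFun Fq q α d s ^ w)⁻¹

open Classical in
theorem aux_count (Fq : Type*) [Field Fq] [Fintype Fq] (n : ℕ) (hn : 0 < n) :
    HasSum (fun P : Polynomial Fq =>
      if P.Monic ∧ Irreducible P ∧ P.natDegree ∣ n then (P.natDegree : ℝ) else 0)
      ((Fintype.card Fq : ℝ) ^ n) := by
  have hq1 : 1 < Fintype.card Fq := Fintype.one_lt_card
  set q := Fintype.card Fq with hq
  set f : Polynomial Fq := X ^ q ^ n - X with hf
  have hqn : 1 < q ^ n := Nat.one_lt_pow hn.ne' hq1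
  have hfm : f.Monic := monic_X_pow_sub (by rw [degree_X]; exact_mod_cast hqn)
  have hf0 : f ≠ 0 := hfm.ne_zero
  have hdeg : f.natDegree = q ^ n := FiniteField.X_pow_card_sub_X_natDegree_eq Fq hqn
  have hsq : Squarefree f := by
    obtain ⟨p, hp⟩ := CharP.exists Fq
    have hpp : p.Prime := CharP.char_is_prime Fq p
    have : p ∣ q ^ n := by
      apply dvd_pow _ hn.ne'
      rw [← CharP.cast_eq_zero_iff Fq p]
      simp [hq]
    exact (galois_poly_separable p _ this).squarefree
  have hnd := (UniqueFactorizationMonoid.squarefree_iff_nodup_normalizedFactors hf0).1 hsq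
  set M := UniqueFactorizationMonoid.normalizedFactors f with hM
  have hmem : ∀ P : Polynomial Fq, P ∈ M.toFinset ↔ P.Monic ∧ Irreducible P ∧ P.natDegree ∣ n := by
    intro P
    rw [Multiset.mem_toFinset, hM, UniqueFactorizationMonoid.mem_normalizedFactors_iff' hf0]
    constructor
    · rintro ⟨h1, h2, h3⟩
      refine ⟨?_, h1, ?_⟩
      · rw [← h2]; exact monic_normalize h1.ne_zero
      · rw [h1.natDegree_dvd_iff_dvd_X_pow_card_pow_sub_X, Nat.card_eq_fintype_card]
        exact h3
    · rintro ⟨h1, h2, h3⟩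
      refine ⟨h2, h1.normalize_eq_self, ?_⟩
      rw [h2.natDegree_dvd_iff_dvd_X_pow_card_pow_sub_X, Nat.card_eq_fintype_card] at h3
      exact h3
  have hsum : ∑ P ∈ M.toFinset, P.natDegree = q ^ n := by
    rw [← hdeg]
    have hprod : M.prod = f := by
      rw [hM, UniqueFactorizationMonoid.prod_normalizedFactors_eq hf0, hfm.normalize_eq_self]
    have : ∏ P ∈ M.toFinset, P = f := by
      rw [← hprod, Finset.prod, Multiset.toFinset_val, hnd.dedup, Multiset.map_id']
    conv_rhs => rw [← this]
    rw [natDegree_prod_of_monic]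
    intro P hP
    exact ((hmem P).1 hP).1
  have h := hasSum_sum_of_ne_finset_zero (L := SummationFilter.unconditional _) (s := M.toFinset) (f := fun P : Polynomial Fq =>
      if P.Monic ∧ Irreducible P ∧ P.natDegree ∣ n then (P.natDegree : ℝ) else 0)
      (by intro P hP; rw [hmem] at hP; simp only [if_neg hP])
  convert! h using 1
  rw [Finset.sum_congr rfl (g := fun P => (P.natDegree : ℝ))
    (by intro P hP; rw [hmem] at hP; simp only [if_pos hP])]
  exact_mod_cast hsum.symm

theorem aux_fiber (α n : ℕ) (hα : 0 < α) (hn : 0 < n) (u : ℝ) (hu : 0 < u) (hu1 : u < 1) :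
    HasSum (fun m : ℕ => if n ∣ (m + 1) * α then
      (n : ℝ) * (u ^ ((m + 1) * α) / ((m : ℝ) + 1)) else 0)
      ((Nat.gcd α n : ℝ) * -Real.log (1 - u ^ (α / Nat.gcd α n * n))) := by
  obtain ⟨g, hg⟩ : ∃ g, g = Nat.gcd α n := ⟨_, rfl⟩
  have hg0 : 0 < g := hg ▸ Nat.gcd_pos_of_pos_left _ hα
  obtain ⟨a, c, hac, ha, hc⟩ := Nat.exists_coprime α n
  rw [← hg] at ha hc ⊢
  have hc0 : 0 < c := Nat.pos_of_ne_zero (by rintro rfl; simp at hc; omega)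
  have ha0 : 0 < a := Nat.pos_of_ne_zero (by rintro rfl; simp at ha; omega)
  have hdiv : α / g = a := by rw [ha]; exact Nat.mul_div_cancel _ hg0
  rw [hdiv]
  have hdvd : ∀ m : ℕ, n ∣ (m + 1) * α ↔ c ∣ m + 1 := by
    intro m
    rw [ha, hc, ← mul_assoc, Nat.mul_dvd_mul_iff_right hg0]
    exact ⟨fun h => hac.symm.dvd_of_dvd_mul_right h, fun h => Dvd.dvd.mul_right h _⟩
  have hx1 : |u ^ (a * n)| < 1 := by
    rw [abs_of_pos (by positivity)]
    exact pow_lt_one₀ hu.le hu1 (by positivity)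
  have h := (Real.hasSum_pow_div_log_of_abs_lt_one hx1).mul_left (g : ℝ)
  have hinj : Function.Injective (fun j : ℕ => c * (j + 1) - 1) := by
    intro i j hij
    have h1 : 0 < c * (i + 1) := by positivity
    have h2 : 0 < c * (j + 1) := by positivity
    simp only at hij
    have h3 : c * (i + 1) = c * (j + 1) := by omega
    have := Nat.eq_of_mul_eq_mul_left hc0 h3
    omega
  rw [← hinj.hasSum_iff]
  · convert! h using 1
    funext j
    have h1 : 0 < c * (j + 1) := by positivity
    have h2 : c * (j + 1) - 1 + 1 = c * (j + 1) := by omega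
    have h3 : ((c * (j + 1) - 1 : ℕ) : ℝ) + 1 = c * (j + 1) := by exact_mod_cast h2
    simp only [Function.comp]
    rw [if_pos ((hdvd _).2 (by rw [h2]; exact dvd_mul_right _ _)), h3, h2, ← pow_mul]
    have h4 : c * (j + 1) * α = a * n * (j + 1) := by rw [ha, hc]; ring
    have h5 : (n : ℝ) = c * g := by exact_mod_cast hc
    have h6 : (c : ℝ) ≠ 0 := by positivity
    rw [h4, h5]
    have h7 : (j : ℝ) + 1 ≠ 0 := by positivity
    field_simp
  · intro m hm
    rw [if_neg]
    rw [hdvd]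
    rintro ⟨k, hk⟩
    apply hm
    have hk0 : k ≠ 0 := by rintro rfl; simp at hk
    refine ⟨k - 1, ?_⟩
    simp only
    rw [Nat.sub_add_cancel (by omega)]
    omega

open Classical in
theorem aux_main (Fq : Type*) [Field Fq] [Fintype Fq] (α : ℕ) (hα : 0 < α) (u : ℝ)
    (hu : 0 < u) (hqu : (Fintype.card Fq : ℝ) * u < 1) :
    HasSum (fun P : Polynomial Fq => if P.Monic ∧ Irreducible P then
      (Nat.gcd α P.natDegree : ℝ) * -Real.log (1 - u ^ (α / Nat.gcd α P.natDegree * P.natDegree))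
      else 0) (-Real.log (1 - ((Fintype.card Fq : ℝ) * u) ^ α)) := by
  have hq1 : (1 : ℝ) < Fintype.card Fq := by exact_mod_cast Fintype.one_lt_card
  set q : ℝ := (Fintype.card Fq : ℝ) with hq
  have hu1 : u < 1 := by nlinarith
  let F : ℕ × Polynomial Fq → ℝ := fun x =>
    if x.2.Monic ∧ Irreducible x.2 ∧ x.2.natDegree ∣ (x.1 + 1) * α then
      (x.2.natDegree : ℝ) * (u ^ ((x.1 + 1) * α) / ((x.1 : ℝ) + 1)) else 0
  have hF0 : 0 ≤ F := by
    intro x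
    simp only [F, Pi.zero_apply]
    split_ifs
    · positivity
    · exact le_rfl
  have h1 : ∀ m : ℕ, HasSum (fun P => F (m, P)) (((q * u) ^ α) ^ (m + 1) / ((m : ℝ) + 1)) := by
    intro m
    have h := (aux_count Fq ((m + 1) * α) (by positivity)).mul_right
      (u ^ ((m + 1) * α) / ((m : ℝ) + 1))
    convert! h using 1
    · funext P
      simp only [F, ite_mul, zero_mul]
    · rw [← pow_mul, mul_pow, mul_comm α]; ring
  have h2 : HasSum (fun m : ℕ => ((q * u) ^ α) ^ (m + 1) / ((m : ℝ) + 1))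
      (-Real.log (1 - (q * u) ^ α)) := by
    apply Real.hasSum_pow_div_log_of_abs_lt_one
    rw [abs_of_pos (by positivity)]
    exact pow_lt_one₀ (by positivity) hqu hα.ne'
  have hFs : Summable F := by
    rw [summable_prod_of_nonneg hF0]
    refine ⟨fun m => (h1 m).summable, ?_⟩
    simp only [fun m => (h1 m).tsum_eq]
    exact h2.summable
  have hFh : HasSum F (-Real.log (1 - (q * u) ^ α)) := by
    have := hFs.hasSum.prod_fiberwise h1
    rw [← this.unique h2]
    exact hFs.hasSum
  have hsw : HasSum (fun x : Polynomial Fq × ℕ => F (x.2, x.1)) (-Real.log (1 - (q * u) ^ α)) :=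
    (Equiv.prodComm _ _).hasSum_iff.2 hFh
  refine hsw.prod_fiberwise ?_
  intro P
  by_cases hP : P.Monic ∧ Irreducible P
  · rw [if_pos hP]
    have := aux_fiber α P.natDegree hα hP.2.natDegree_pos u hu hu1
    convert! this using 1
    funext m
    simp only [F, hP.1, hP.2, true_and]
  · rw [if_neg hP]
    have : ∀ m : ℕ, F (m, P) = 0 := by
      intro m
      simp only [F]
      rw [if_neg]
      tauto
    simp only [this]
    exact hasSum_zero

theorem aux_summ (Fq : Type*) [Field Fq] [Fintype Fq] (p : Polynomial Fq → Prop) (v : ℝ)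
    (hv : 0 < v) (hqv : (Fintype.card Fq : ℝ) * v < 1) :
    Summable (fun P : {P : Polynomial Fq // P.Monic ∧ Irreducible P ∧ p P} =>
      v ^ P.1.natDegree) := by
  classical
  have hq1 : (1 : ℝ) < Fintype.card Fq := by exact_mod_cast Fintype.one_lt_card
  have hv1 : v < 1 := by nlinarith
  have h := (aux_main Fq 1 one_pos v hv hqv).summable
  have h2 := h.comp_injective (Subtype.val_injective
    (p := fun P : Polynomial Fq => P.Monic ∧ Irreducible P ∧ p P))
  refine Summable.of_nonneg_of_le (fun P => by positivity) (fun P => ?_) h2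
  simp only [Function.comp]
  rw [if_pos ⟨P.2.1, P.2.2.1⟩]
  simp only [Nat.gcd_one_left, Nat.cast_one, one_mul, Nat.div_one]
  have hx : v ^ P.1.natDegree < 1 := pow_lt_one₀ hv.le hv1 P.2.2.1.natDegree_pos.ne'
  have := Real.log_le_sub_one_of_pos (sub_pos.2 hx)
  linarith

/-- bound for `log (1 - x)` -/
theorem aux_log (x c : ℝ) (hx : 0 < x) (hxc : x ≤ c) (hc : c < 1) :
    -Real.log (1 - x) ≤ x + x ^ 2 / (1 - c) := by
  have h1 : 0 < 1 - x := by linarith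
  have h2 : 0 < 1 - c := by linarith
  have h := Real.log_le_sub_one_of_pos (inv_pos.2 h1)
  rw [Real.log_inv] at h
  have h3 : (1 - x)⁻¹ - 1 = x + x ^ 2 / (1 - x) := by field_simp; ring
  have h4 : x ^ 2 / (1 - x) ≤ x ^ 2 / (1 - c) := by gcongr
  linarith

theorem aux_log_nonneg (x : ℝ) (hx : 0 < x) (hc : x < 1) :
    x ≤ -Real.log (1 - x) := by
  have := Real.log_le_sub_one_of_pos (sub_pos.2 hc)
  linarith

theorem aux_log_h (x c m : ℝ) (hx : 0 < x) (hxc : x ≤ c) (hc : c < 1) (hm : 0 ≤ m) :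
    |Real.log (1 + m * x) + m * Real.log (1 - x)| ≤ (m ^ 2 + m / (1 - c)) * x ^ 2 := by
  have h1 := aux_log x c hx hxc hc
  have h2 := aux_log_nonneg x hx (by linarith)
  have hy : 0 < 1 + m * x := by positivity
  have h3 := Real.log_le_sub_one_of_pos hy
  have h4 := Real.log_le_sub_one_of_pos (inv_pos.2 hy)
  rw [Real.log_inv] at h4
  have h5 : (1 + m * x)⁻¹ ≤ 1 - m * x + (m * x) ^ 2 := by
    rw [inv_le_iff_one_le_mul₀ hy]
    have : 0 ≤ (m * x) ^ 3 := by positivity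
    nlinarith
  have h6 := mul_le_mul_of_nonneg_left h1 hm
  have h7 := mul_le_mul_of_nonneg_left h2 hm
  have h8 : m * (x + x ^ 2 / (1 - c)) = m * x + m / (1 - c) * x ^ 2 := by ring
  have h10 : 0 < 1 - c := by linarith
  have h9 : 0 ≤ (m ^ 2 + m / (1 - c)) * x ^ 2 := by positivity
  rw [abs_le]
  constructor <;> nlinarith

/-- the rpow expressions in terms of `u = q^(-s)` -/
theorem aux_rpow (q : ℝ) (hq : 0 < q) (n : ℕ) (s : ℝ) :
    q ^ (-(n : ℝ) * s) = (q ^ (-s)) ^ n := by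
  rw [← Real.rpow_mul_natCast hq.le]; congr 1; ring

theorem aux_h_summ (Fq : Type*) [Field Fq] [Fintype Fq] (p : Polynomial Fq → Prop) (u m : ℝ)
    (hu : 0 < u) (hu1 : u < 1) (hqu : (Fintype.card Fq : ℝ) * u ^ 2 < 1) (hm : 0 ≤ m) :
    Summable (fun P : {P : Polynomial Fq // P.Monic ∧ Irreducible P ∧ p P} =>
      Real.log (1 + m * u ^ P.1.natDegree) + m * Real.log (1 - u ^ P.1.natDegree)) := by
  have h := (aux_summ Fq p (u ^ 2) (by positivity) hqu).mul_left (m ^ 2 + m / (1 - u))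
  refine Summable.of_norm_bounded h (fun P => ?_)
  rw [Real.norm_eq_abs, ← pow_mul, mul_comm 2, pow_mul]
  exact aux_log_h _ u m (by positivity)
    (pow_le_of_le_one hu.le hu1.le P.2.2.1.natDegree_pos.ne') hu1 hm

theorem aux_L_summ (Fq : Type*) [Field Fq] [Fintype Fq] (p : Polynomial Fq → Prop) (u : ℝ) (k : ℕ)
    (hk : 0 < k)
    (hu : 0 < u) (hu1 : u < 1) (hqu : (Fintype.card Fq : ℝ) * u ^ k < 1) :
    Summable (fun P : {P : Polynomial Fq // P.Monic ∧ Irreducible P ∧ p P} =>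
      Real.log (1 - u ^ (k * P.1.natDegree))) := by
  have h := (aux_summ Fq p (u ^ k) (by positivity) hqu).mul_left (1 + 1 / (1 - u))
  refine Summable.of_norm_bounded h (fun P => ?_)
  have hn := P.2.2.1.natDegree_pos
  rw [Real.norm_eq_abs, ← pow_mul]
  have hx : 0 < u ^ (k * P.1.natDegree) := by positivity
  have hxu : u ^ (k * P.1.natDegree) ≤ u := pow_le_of_le_one hu.le hu1.le (by positivity)
  set x := u ^ (k * P.1.natDegree)
  have h1 := aux_log x u hx hxu hu1
  have h2 := aux_log_nonneg x hx (by linarith)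
  have h3 : 0 < 1 - u := by linarith
  have h4 : x ^ 2 / (1 - u) ≤ x / (1 - u) := by gcongr; nlinarith
  rw [abs_of_neg (by linarith)]
  calc _ ≤ _ := h1
    _ ≤ x + x / (1 - u) := by linarith
    _ = _ := by ring

open Classical in
theorem aux_split (Fq : Type*) [Field Fq] [Fintype Fq] (α : ℕ) (hα : 0 < α) (u : ℝ)
    (hu : 0 < u) (hqu : (Fintype.card Fq : ℝ) * u < 1) :
    ∑ d ∈ α.divisors,
      ∑' P : {P : Polynomial Fq // P.Monic ∧ Irreducible P ∧ Nat.gcd α P.natDegree = d},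
        (d : ℝ) * -Real.log (1 - u ^ (α / d * P.1.natDegree)) =
      -Real.log (1 - ((Fintype.card Fq : ℝ) * u) ^ α) := by
  have h := aux_main Fq α hα u hu hqu
  rw [← h.tsum_eq]
  set G : Polynomial Fq → ℝ := (fun P : Polynomial Fq => if P.Monic ∧ Irreducible P then
      (Nat.gcd α P.natDegree : ℝ) * -Real.log (1 - u ^ (α / Nat.gcd α P.natDegree * P.natDegree))
      else 0) with hG
  have key : ∀ d ∈ α.divisors,
      HasSum ({P : Polynomial Fq | P.Monic ∧ Irreducible P ∧ Nat.gcd α P.natDegree = d}.indicator G)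
      (∑' P : {P : Polynomial Fq // P.Monic ∧ Irreducible P ∧ Nat.gcd α P.natDegree = d},
        (d : ℝ) * -Real.log (1 - u ^ (α / d * P.1.natDegree))) := by
    intro d _
    rw [← hasSum_subtype_iff_indicator]
    have h1 := (h.summable.subtype
      {P : Polynomial Fq | P.Monic ∧ Irreducible P ∧ Nat.gcd α P.natDegree = d}).hasSum
    convert! h1 using 1
    apply tsum_congr
    intro P
    obtain ⟨P, hP1, hP2, rfl⟩ := P
    simp [hG, hP1, hP2]
  have h2 := hasSum_sum key
  rw [← h2.tsum_eq]
  apply tsum_congr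
  intro P
  by_cases hP : P.Monic ∧ Irreducible P
  · rw [Finset.sum_eq_single (Nat.gcd α P.natDegree)]
    · rw [Set.indicator_of_mem]
      exact ⟨hP.1, hP.2, rfl⟩
    · intro d _ hd
      rw [Set.indicator_of_notMem]
      rintro ⟨_, _, h3⟩
      exact hd h3.symm
    · intro h3
      exact absurd (Nat.mem_divisors.2 ⟨Nat.gcd_dvd_left _ _, hα.ne'⟩) h3
  · rw [Finset.sum_eq_zero]
    · rw [if_neg hP]
    · intro d _
      rw [Set.indicator_of_notMem]
      rintro ⟨h3, h4, _⟩
      exact hP ⟨h3, h4⟩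

theorem aux_L_prod (Fq : Type*) [Field Fq] [Fintype Fq] (q α d : ℕ) (hq : Fintype.card Fq = q)
    (hk : 0 < α / d) (s : ℝ) (hs : 0 < s) (hqu : (q : ℝ) * ((q : ℝ) ^ (-s)) ^ (α / d) < 1) :
    Multipliable
          (fun P : {P : Polynomial Fq // P.Monic ∧ Irreducible P ∧ Nat.gcd α P.natDegree = d} =>
            ((1 - (q : ℝ) ^ (-((α / d * P.1.natDegree : ℕ) : ℝ) * s)) ^ d)⁻¹) ∧
      LFun Fq q α d s = Real.exp (
        ∑' P : {P : Polynomial Fq // P.Monic ∧ Irreducible P ∧ Nat.gcd α P.natDegree = d},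
        (d : ℝ) * -Real.log (1 - ((q : ℝ) ^ (-s)) ^ (α / d * P.1.natDegree))) := by
  have hq1 : (1 : ℝ) < q := by rw [← hq]; exact_mod_cast Fintype.one_lt_card
  have hq0 : (0 : ℝ) < q := by linarith
  have hu : 0 < (q : ℝ) ^ (-s) := Real.rpow_pos_of_pos hq0 _
  have hu1 : (q : ℝ) ^ (-s) < 1 := Real.rpow_lt_one_of_one_lt_of_neg hq1 (by linarith)
  unfold LFun
  simp only [aux_rpow (q : ℝ) hq0]
  set u := (q : ℝ) ^ (-s) with hu_def
  have h := aux_L_summ Fq (fun P => Nat.gcd α P.natDegree = d) u (α / d) hk hu hu1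
    (by rw [hq]; exact hqu)
  have hlog : ∀ P : {P : Polynomial Fq // P.Monic ∧ Irreducible P ∧ Nat.gcd α P.natDegree = d},
      Real.log (((1 - u ^ (α / d * P.1.natDegree)) ^ d)⁻¹) =
        (d : ℝ) * -Real.log (1 - u ^ (α / d * P.1.natDegree)) := by
    intro P
    rw [Real.log_inv, Real.log_pow]; ring
  have hpos : ∀ P : {P : Polynomial Fq // P.Monic ∧ Irreducible P ∧ Nat.gcd α P.natDegree = d},
      0 < ((1 - u ^ (α / d * P.1.natDegree)) ^ d)⁻¹ := by
    intro P
    have hn := P.2.2.1.natDegree_pos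
    have : u ^ (α / d * P.1.natDegree) < 1 := pow_lt_one₀ hu.le hu1 (by positivity)
    have : 0 < 1 - u ^ (α / d * P.1.natDegree) := by linarith
    positivity
  have hs2 : Summable (fun P : {P : Polynomial Fq //
      P.Monic ∧ Irreducible P ∧ Nat.gcd α P.natDegree = d} =>
      Real.log (((1 - u ^ (α / d * P.1.natDegree)) ^ d)⁻¹)) := by
    simp only [hlog]
    exact h.neg.mul_left _
  refine ⟨Real.multipliable_of_summable_log hpos hs2, ?_⟩
  rw [← Real.rexp_tsum_eq_tprod hpos hs2]
  simp only [hlog]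

theorem aux_h_prod (Fq : Type*) [Field Fq] [Fintype Fq] (q ℓ α : ℕ) (hq : Fintype.card Fq = q)
    (hℓ : 1 ≤ ℓ) (s : ℝ) (hs : 0 < s) (hqu : (q : ℝ) * ((q : ℝ) ^ (-s)) ^ 2 < 1) :
    Multipliable
          (fun P : {P : Polynomial Fq // P.Monic ∧ Irreducible P ∧ α ∣ P.natDegree} =>
            (1 + ((ℓ : ℝ) - 1) * (q : ℝ) ^ (-(P.1.natDegree : ℝ) * s)) *
              (1 - (q : ℝ) ^ (-(P.1.natDegree : ℝ) * s)) ^ (ℓ - 1)) ∧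
      hFun Fq q ℓ α s = Real.exp (
        ∑' P : {P : Polynomial Fq // P.Monic ∧ Irreducible P ∧ α ∣ P.natDegree},
        (Real.log (1 + ((ℓ : ℝ) - 1) * ((q : ℝ) ^ (-s)) ^ P.1.natDegree) +
          ((ℓ : ℝ) - 1) * Real.log (1 - ((q : ℝ) ^ (-s)) ^ P.1.natDegree))) := by
  have hq1 : (1 : ℝ) < q := by rw [← hq]; exact_mod_cast Fintype.one_lt_card
  have hq0 : (0 : ℝ) < q := by linarith
  have hu : 0 < (q : ℝ) ^ (-s) := Real.rpow_pos_of_pos hq0 _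
  have hu1 : (q : ℝ) ^ (-s) < 1 := Real.rpow_lt_one_of_one_lt_of_neg hq1 (by linarith)
  have hm : (0 : ℝ) ≤ (ℓ : ℝ) - 1 := by
    have : (1 : ℝ) ≤ ℓ := by exact_mod_cast hℓ
    linarith
  unfold hFun
  simp only [aux_rpow (q : ℝ) hq0]
  set u := (q : ℝ) ^ (-s) with hu_def
  have h := aux_h_summ Fq (fun P => α ∣ P.natDegree) u ((ℓ : ℝ) - 1) hu hu1
    (by rw [hq]; exact hqu) hm
  have hpos1 : ∀ P : {P : Polynomial Fq // P.Monic ∧ Irreducible P ∧ α ∣ P.natDegree},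
      0 < 1 - u ^ P.1.natDegree := by
    intro P
    have hn := P.2.2.1.natDegree_pos
    have : u ^ P.1.natDegree < 1 := pow_lt_one₀ hu.le hu1 (by positivity)
    linarith
  have hlog : ∀ P : {P : Polynomial Fq // P.Monic ∧ Irreducible P ∧ α ∣ P.natDegree},
      Real.log ((1 + ((ℓ : ℝ) - 1) * u ^ P.1.natDegree) * (1 - u ^ P.1.natDegree) ^ (ℓ - 1)) =
      Real.log (1 + ((ℓ : ℝ) - 1) * u ^ P.1.natDegree) +
          ((ℓ : ℝ) - 1) * Real.log (1 - u ^ P.1.natDegree) := by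
    intro P
    rw [Real.log_mul (by positivity) (pow_ne_zero _ (hpos1 P).ne'), Real.log_pow,
      Nat.cast_sub hℓ, Nat.cast_one]
  have hpos : ∀ P : {P : Polynomial Fq // P.Monic ∧ Irreducible P ∧ α ∣ P.natDegree},
      0 < (1 + ((ℓ : ℝ) - 1) * u ^ P.1.natDegree) * (1 - u ^ P.1.natDegree) ^ (ℓ - 1) := by
    intro P
    have := hpos1 P
    positivity
  have hs2 : Summable (fun P : {P : Polynomial Fq //
      P.Monic ∧ Irreducible P ∧ α ∣ P.natDegree} =>
      Real.log ((1 + ((ℓ : ℝ) - 1) * u ^ P.1.natDegree) *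
        (1 - u ^ P.1.natDegree) ^ (ℓ - 1))) := by
    simp only [hlog]
    exact h
  refine ⟨Real.multipliable_of_summable_log hpos hs2, ?_⟩
  rw [← Real.rexp_tsum_eq_tprod hpos hs2]
  simp only [hlog]

theorem aux_half (q : ℝ) (hq : 1 < q) (s : ℝ) (hs : 1 / 2 < s) :
    q * (q ^ (-s)) ^ 2 < 1 := by
  have hq0 : 0 < q := by linarith
  have : q * (q ^ (-s)) ^ 2 = q ^ (1 + -s * 2) := by
    rw [Real.rpow_add hq0, Real.rpow_one, Real.rpow_mul hq0.le]
    norm_num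
  rw [this]
  exact Real.rpow_lt_one_of_one_lt_of_neg hq (by linarith)

theorem aux_half_k (q : ℝ) (hq : 1 < q) (s : ℝ) (hs : 1 / 2 < s) (k : ℕ) (hk : 2 ≤ k) :
    q * (q ^ (-s)) ^ k < 1 := by
  have hq0 : 0 < q := by linarith
  have hu : 0 < q ^ (-s) := Real.rpow_pos_of_pos hq0 _
  have hu1 : q ^ (-s) < 1 := Real.rpow_lt_one_of_one_lt_of_neg hq (by linarith)
  refine lt_of_le_of_lt ?_ (aux_half q hq s hs)
  exact mul_le_mul_of_nonneg_left (pow_le_pow_of_le_one hu.le hu1.le hk) hq0.le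

theorem aux_two_le (α d : ℕ) (hα : 0 < α) (hd : d ∣ α) (hne : d ≠ α) : 2 ≤ α / d := by
  obtain ⟨k, rfl⟩ := hd
  have hd0 : 0 < d := Nat.pos_of_mul_pos_right hα
  rw [Nat.mul_div_cancel_left _ hd0]
  rcases k with _ | _ | k
  · simp at hα
  · simp at hne
  · omega

theorem stmt3 (Fq : Type*) [Field Fq] [Fintype Fq] (q ℓ α w : ℕ)
    (hq : Fintype.card Fq = q) (hℓ : ℓ.Prime) (hℓq : ¬ ℓ ∣ q)
    (hα : α = orderOf (q : ZMod ℓ)) (hw : α * w = ℓ - 1) :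
    (∀ s : ℝ, 1 < s →
        ∏' P : {P : Polynomial Fq // P.Monic ∧ Irreducible P ∧ α ∣ P.natDegree},
            (1 + ((ℓ : ℝ) - 1) * (q : ℝ) ^ (-(P.1.natDegree : ℝ) * s)) =
          ((1 - (q : ℝ) ^ ((α : ℝ) * (1 - s)))⁻¹) ^ w * gFun Fq q ℓ α w s) ∧
      (∀ s : ℝ, 1 / 2 < s →
        Multipliable
          (fun P : {P : Polynomial Fq // P.Monic ∧ Irreducible P ∧ α ∣ P.natDegree} =>
            (1 + ((ℓ : ℝ) - 1) * (q : ℝ) ^ (-(P.1.natDegree : ℝ) * s)) *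
              (1 - (q : ℝ) ^ (-(P.1.natDegree : ℝ) * s)) ^ (ℓ - 1))) ∧
      (∀ d : ℕ, d ∣ α → d ≠ α → ∀ s : ℝ, 1 / 2 < s →
        Multipliable
          (fun P : {P : Polynomial Fq // P.Monic ∧ Irreducible P ∧ Nat.gcd α P.natDegree = d} =>
            ((1 - (q : ℝ) ^ (-((α / d * P.1.natDegree : ℕ) : ℝ) * s)) ^ d)⁻¹)) ∧
      0 < gFun Fq q ℓ α w 1 := by
  have hq1 : (1 : ℝ) < q := by rw [← hq]; exact_mod_cast Fintype.one_lt_card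
  have hq0 : (0 : ℝ) < q := by linarith
  have hℓ1 : 1 ≤ ℓ := hℓ.one_le
  have hα0 : 0 < α := by
    rcases Nat.eq_zero_or_pos α with h | h
    · rw [h] at hw
      have := hℓ.two_le
      omega
    · exact h
  have hm : (0 : ℝ) ≤ (ℓ : ℝ) - 1 := by
    have : (1 : ℝ) ≤ ℓ := by exact_mod_cast hℓ1
    linarith
  have hL : ∀ d ∈ α.divisors.erase α, ∀ s : ℝ, 1 / 2 < s → LFun Fq q α d s = Real.exp (
        ∑' P : {P : Polynomial Fq // P.Monic ∧ Irreducible P ∧ Nat.gcd α P.natDegree = d},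
        (d : ℝ) * -Real.log (1 - ((q : ℝ) ^ (-s)) ^ (α / d * P.1.natDegree))) := by
    intro d hd s hs
    rw [Finset.mem_erase, Nat.mem_divisors] at hd
    have hk := aux_two_le α d hα0 hd.2.1 hd.1
    exact (aux_L_prod Fq q α d hq (by omega) s (by linarith) (aux_half_k _ hq1 s hs _ hk)).2
  refine ⟨?_, ?_, ?_, ?_⟩
  · intro s hs
    have hu : 0 < (q : ℝ) ^ (-s) := Real.rpow_pos_of_pos hq0 _
    have hu1 : (q : ℝ) ^ (-s) < 1 := Real.rpow_lt_one_of_one_lt_of_neg hq1 (by linarith)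
    have hqu' : (q : ℝ) * (q : ℝ) ^ (-s) = (q : ℝ) ^ (1 - s) := by
      rw [sub_eq_add_neg, Real.rpow_add hq0, Real.rpow_one]
    have hqu : (q : ℝ) * (q : ℝ) ^ (-s) < 1 := by
      rw [hqu']
      exact Real.rpow_lt_one_of_one_lt_of_neg hq1 (by linarith)
    have hZ : (q : ℝ) ^ ((α : ℝ) * (1 - s)) = ((q : ℝ) * (q : ℝ) ^ (-s)) ^ α := by
      rw [hqu', ← Real.rpow_mul_natCast hq0.le, mul_comm]
    have hZ1 : ((q : ℝ) * (q : ℝ) ^ (-s)) ^ α < 1 := pow_lt_one₀ (by positivity) hqu hα0.ne'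
    have hh := (aux_h_prod Fq q ℓ α hq hℓ1 s (by linarith) (aux_half _ hq1 s (by linarith))).2
    have hsplit := aux_split Fq α hα0 ((q : ℝ) ^ (-s)) hu (by rw [hq]; exact hqu)
    rw [hq, ← Finset.add_sum_erase _ _ (Nat.mem_divisors_self α hα0.ne')] at hsplit
    unfold gFun
    rw [hh, Finset.prod_congr rfl (fun d hd => by rw [hL d hd s (by linarith)]), hZ]
    simp only [aux_rpow (q : ℝ) hq0]
    set u := (q : ℝ) ^ (-s) with hu_def
    have hs1 : Summable (fun P : {P : Polynomial Fq //
        P.Monic ∧ Irreducible P ∧ α ∣ P.natDegree} => Real.log (1 - u ^ P.1.natDegree)) := by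
      have := aux_L_summ Fq (fun P => α ∣ P.natDegree) u 1 one_pos hu hu1
        (by rw [hq, pow_one]; exact hqu)
      simpa only [one_mul] using this
    have hs2 := aux_h_summ Fq (fun P => α ∣ P.natDegree) u ((ℓ : ℝ) - 1) hu hu1
      (by rw [hq]; exact aux_half _ hq1 s (by linarith)) hm
    have hs3 : Summable (fun P : {P : Polynomial Fq //
        P.Monic ∧ Irreducible P ∧ α ∣ P.natDegree} =>
        Real.log (1 + ((ℓ : ℝ) - 1) * u ^ P.1.natDegree)) := by
      have := hs2.sub (hs1.mul_left ((ℓ : ℝ) - 1))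
      simpa only [add_sub_cancel_right] using this
    rw [← Real.rexp_tsum_eq_tprod (fun P => by positivity) hs3,
      hs3.tsum_add (hs1.mul_left _), tsum_mul_left]
    have hα_eq : (∑' P : {P : Polynomial Fq //
        P.Monic ∧ Irreducible P ∧ Nat.gcd α P.natDegree = α},
        (α : ℝ) * -Real.log (1 - u ^ (α / α * P.1.natDegree))) =
        -((α : ℝ) * ∑' P : {P : Polynomial Fq // P.Monic ∧ Irreducible P ∧ α ∣ P.natDegree},
          Real.log (1 - u ^ P.1.natDegree)) := by
      simp only [Nat.div_self hα0, one_mul, mul_neg]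
      rw [tsum_neg, tsum_mul_left]
      congr 2
      exact (Equiv.subtypeEquivRight (fun P : Polynomial Fq => by
        rw [Nat.gcd_eq_left_iff_dvd] :
          ∀ P : Polynomial Fq, (P.Monic ∧ Irreducible P ∧ Nat.gcd α P.natDegree = α) ↔
            (P.Monic ∧ Irreducible P ∧ α ∣ P.natDegree))).tsum_eq
          (fun P => Real.log (1 - u ^ P.1.natDegree))
    rw [hα_eq] at hsplit
    have hexp : (1 - ((q : ℝ) * u) ^ α)⁻¹ = Real.exp (-Real.log (1 - ((q : ℝ) * u) ^ α)) := by
      rw [Real.exp_neg, Real.exp_log (by linarith)]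
    rw [hexp, ← hsplit]
    simp only [← Real.exp_nat_mul, ← Real.exp_neg, ← Real.exp_sum, ← Real.exp_add]
    congr 1
    have hwR : (ℓ : ℝ) - 1 = α * w := by
      rw [← Nat.cast_one, ← Nat.cast_sub hℓ1, ← hw, Nat.cast_mul]
    rw [Finset.sum_neg_distrib, ← Finset.mul_sum, hwR]
    ring
  · intro s hs
    exact (aux_h_prod Fq q ℓ α hq hℓ1 s (by linarith) (aux_half _ hq1 s hs)).1
  · intro d hd hne s hs
    have hk := aux_two_le α d hα0 hd hne
    exact (aux_L_prod Fq q α d hq (by omega) s (by linarith) (aux_half_k _ hq1 s hs _ hk)).1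
  · unfold gFun
    rw [(aux_h_prod Fq q ℓ α hq hℓ1 1 (by norm_num) (aux_half _ hq1 1 (by norm_num))).2]
    refine mul_pos (Real.exp_pos _) (Finset.prod_pos fun d hd => ?_)
    rw [hL d hd 1 (by norm_num)]
    positivity
end
end

section
/- Let t ∈ ℂ be a complex number that is not zero or a negative integer. Then, as n → ∞, n!·n^t / ∏_{i=0}^{n} (t+i) = Γ(t)·[1 − (t²+t)/(2n) + O(1/n²)]; that is, there is a constant C > 0 such that for all sufficiently large n, |n!·n^t/∏_{i=0}^{n}(t+i) − Γ(t)·(1 − (t²+t)/(2n))| ≤ C/n². -/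
open Filter Finset

open Topology Asymptotics in
theorem aux_binom (t : ℂ) :
    (fun x : ℂ => (1 + x) ^ t - (1 + t * x + t * (t - 1) / 2 * x ^ 2)) =O[𝓝 0]
      fun x => x ^ 3 := by
  have h := (Complex.one_add_cpow_hasFPowerSeriesAt_zero (a := t)).isBigO_sub_partialSum_pow 3
  have h2 : Ring.choose t 2 = t * (t - 1) / 2 := by
    rw [Ring.choose_eq_smul]
    simp [descPochhammer_succ_right, Polynomial.smeval_mul, Polynomial.smeval_sub,
      Polynomial.smeval_X, Polynomial.smeval_one, Nat.factorial]
    ring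
  refine IsBigO.trans (h.congr_left ?_) (IsBigO.of_norm_left (IsBigO.of_bound 1 (by simp)))
  intro x
  simp [FormalMultilinearSeries.partialSum, Finset.sum_range_succ, h2, binomialSeries,
    FormalMultilinearSeries.coeff_ofScalars]
  ring

open Topology Asymptotics in
theorem aux_D (t c : ℂ) (hc : c = (t ^ 2 + t) / 2) :
    (fun x : ℂ => ((1 + (1 + c) * x) * (1 + x) ^ t - (1 + c * x) * (1 + (1 + t) * x)) /
      (1 + (1 + t) * x)) =O[𝓝 0] fun x => x ^ 3 := by
  have h1 : (fun x : ℂ => (1 + (1 + c) * x)) =O[𝓝 0] fun _ => (1 : ℂ) :=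
    Tendsto.isBigO_one ℂ (ContinuousAt.tendsto (by fun_prop))
  have h2 : (fun x : ℂ => (1 + (1 + t) * x)⁻¹) =O[𝓝 0] fun _ => (1 : ℂ) :=
    Tendsto.isBigO_one ℂ (ContinuousAt.tendsto (ContinuousAt.inv₀ (by fun_prop) (by simp)))
  have h3 : (fun x : ℂ => (1 + c) * (t * (t - 1) / 2) * x ^ 3) =O[𝓝 0] fun x => x ^ 3 :=
    isBigO_const_mul_self _ _ _
  have h4 := (((h1.mul (aux_binom t)).congr_right (by simp)).add h3).mul h2
  refine (h4.congr_left ?_).congr_right (by simp)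
  intro x
  rw [div_eq_mul_inv]
  congr 1
  subst hc
  ring

theorem aux_rec (t : ℂ) (ht : ∀ n : ℕ, t ≠ -(n : ℂ)) (c : ℂ) (n : ℕ) (hn : n ≠ 0) :
    Complex.GammaSeq t (n + 1) * (1 + c / ((n + 1 : ℕ) : ℂ)) -
      Complex.GammaSeq t n * (1 + c / (n : ℂ)) = Complex.GammaSeq t n *
      (((1 + (1 + c) * (n : ℂ)⁻¹) * (1 + (n : ℂ)⁻¹) ^ t -
        (1 + c * (n : ℂ)⁻¹) * (1 + (1 + t) * (n : ℂ)⁻¹)) / (1 + (1 + t) * (n : ℂ)⁻¹)) := by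
  have hn0 : (n : ℂ) ≠ 0 := Nat.cast_ne_zero.mpr hn
  have hn1 : (n : ℂ) + 1 ≠ 0 := by exact_mod_cast Nat.succ_ne_zero n
  have hnt : t + ((n : ℂ) + 1) ≠ 0 := by
    intro h
    apply ht (n + 1)
    push_cast
    exact eq_neg_of_add_eq_zero_left h
  have hnt' : (n : ℂ) + 1 + t ≠ 0 := by rwa [add_comm]
  have hp : ((n + 1 : ℕ) : ℂ) ^ t = (n : ℂ) ^ t * (1 + (n : ℂ)⁻¹) ^ t := by
    have := Complex.mul_cpow_ofReal_nonneg (a := n) (b := 1 + (n : ℝ)⁻¹) (by positivity)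
      (by positivity) t
    push_cast at this
    rw [← this]
    congr 1
    push_cast
    field_simp
  have hP : ∏ j ∈ Finset.range (n + 1), (t + (j : ℂ)) ≠ 0 := by
    rw [Finset.prod_ne_zero_iff]
    intro j _ h
    exact ht j (eq_neg_of_add_eq_zero_left h)
  have hr : Complex.GammaSeq t (n + 1) =
      Complex.GammaSeq t n * (((n : ℂ) + 1) / (t + (n + 1)) * (1 + (n : ℂ)⁻¹) ^ t) := by
    unfold Complex.GammaSeq
    rw [hp, Finset.prod_range_succ _ (n + 1), Nat.factorial_succ]
    push_cast
    field_simp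
  rw [hr]
  push_cast
  generalize (1 + (n : ℂ)⁻¹) ^ t = p
  have e : 1 + (1 + t) * (n : ℂ)⁻¹ = (t + (n + 1)) / n := by field_simp; ring
  rw [e]
  generalize Complex.GammaSeq t n = g
  field_simp
  ring

theorem aux_tele (b : ℕ → ℂ) (L : ℂ) (K : ℝ) (hb : Tendsto b atTop (nhds L)) (N : ℕ)
    (hN : 1 ≤ N) (hK : 0 ≤ K) (h : ∀ n ≥ N, ‖b (n + 1) - b n‖ ≤ K * (1 / (n : ℝ) ^ 3)) :
    ∀ n ≥ N, ‖L - b n‖ ≤ 2 * K / (n : ℝ) ^ 2 := by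
  intro n hn
  have key : ∀ m ≥ n, ‖b m - b n‖ ≤ 2 * K * (1 / (n : ℝ) ^ 2 - 1 / (m : ℝ) ^ 2) := by
    intro m hm
    induction m, hm using Nat.le_induction with
    | base => simp
    | succ m hm ih =>
      have h1 := h m (by omega)
      have hm0 : (1 : ℝ) ≤ m := by exact_mod_cast (by omega : 1 ≤ m)
      have h2 : 1 / (m : ℝ) ^ 3 ≤ 2 * (1 / (m : ℝ) ^ 2 - 1 / ((m : ℝ) + 1) ^ 2) := by
        rw [div_sub_div _ _ (by positivity) (by positivity), ← mul_div_assoc,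
          div_le_div_iff₀ (by positivity) (by positivity)]
        nlinarith [pow_pos (by linarith : (0 : ℝ) < m) 2, pow_pos (by linarith : (0 : ℝ) < m) 3,
          pow_le_pow_left₀ (by norm_num) hm0 2,
          mul_nonneg (sq_nonneg (m : ℝ)) (by nlinarith : 0 ≤ 3 * (m : ℝ) ^ 2 - 1)]
      have h3 : ‖b (m + 1) - b n‖ ≤ ‖b (m + 1) - b m‖ + ‖b m - b n‖ := norm_sub_le_norm_sub_add_norm_sub _ _ _
      have h4 := mul_le_mul_of_nonneg_left h2 hK
      push_cast
      nlinarith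
  have hl : Tendsto (fun m => ‖b m - b n‖) atTop (nhds ‖L - b n‖) := (hb.sub_const _).norm
  refine le_of_tendsto hl ?_
  filter_upwards [eventually_ge_atTop n] with m hm
  refine (key m hm).trans ?_
  rw [mul_sub, mul_one_div]
  have : 0 ≤ 2 * K * (1 / (m : ℝ) ^ 2) := by positivity
  linarith

theorem stmt8 (t : ℂ) (ht : ∀ n : ℕ, t ≠ -(n : ℂ)) :
    ∃ C > (0 : ℝ), ∀ᶠ n : ℕ in atTop,
      ‖(n.factorial : ℂ) * (n : ℂ) ^ t / (∏ i ∈ Finset.range (n + 1), (t + (i : ℂ))) -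
          Complex.Gamma t * (1 - (t ^ 2 + t) / (2 * (n : ℂ)))‖ ≤ C / (n : ℝ) ^ 2 := by
  obtain ⟨c, hc⟩ : ∃ c, c = (t ^ 2 + t) / 2 := ⟨_, rfl⟩
  have hinv : Tendsto (fun n : ℕ => (n : ℂ)⁻¹) atTop (nhds 0) :=
    tendsto_inv_atTop_nhds_zero_nat
  have hG := Complex.GammaSeq_tendsto_Gamma t
  have hGb := hG.isBigO_one ℂ
  have hD := hGb.mul ((aux_D t c hc).comp_tendsto hinv)
  obtain ⟨K, hK, hD⟩ := hD.exists_pos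
  obtain ⟨A, hA, hGb⟩ := hGb.exists_pos
  have hD := hD.bound
  have hGb := hGb.bound
  obtain ⟨N, hN⟩ := eventually_atTop.1 hD
  have hb : Tendsto (fun n : ℕ => Complex.GammaSeq t n * (1 + c / (n : ℂ))) atTop
      (nhds (Complex.Gamma t)) := by
    have := hG.mul ((hinv.const_mul c).const_add 1)
    simpa [div_eq_mul_inv] using this
  have tele := aux_tele _ _ K hb (N + 1) (by omega) hK.le (by
    intro n hn
    rw [aux_rec t ht c n (by omega)]
    simpa using hN n (by omega))
  refine ⟨2 * K * (1 + ‖c‖) + A * ‖c‖ ^ 2, by positivity, ?_⟩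
  filter_upwards [hGb, eventually_ge_atTop (N + 1)] with n h1 hn
  have h2 := tele n hn
  have hn1 : (1 : ℝ) ≤ n := by exact_mod_cast (by omega : 1 ≤ n)
  have hn0 : (n : ℂ) ≠ 0 := Nat.cast_ne_zero.mpr (by omega)
  have e : (n.factorial : ℂ) * (n : ℂ) ^ t / (∏ i ∈ Finset.range (n + 1), (t + (i : ℂ))) -
          Complex.Gamma t * (1 - (t ^ 2 + t) / (2 * (n : ℂ))) =
      -((Complex.Gamma t - Complex.GammaSeq t n * (1 + c / (n : ℂ))) * (1 - c / n)) +
        Complex.GammaSeq t n * (c / n) ^ 2 := by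
    have : (n.factorial : ℂ) * (n : ℂ) ^ t / (∏ i ∈ Finset.range (n + 1), (t + (i : ℂ))) =
      Complex.GammaSeq t n := by rw [Complex.GammaSeq, mul_comm]
    rw [this, ← div_div, ← hc]
    ring
  rw [e]
  have h3 : ‖1 - c / (n : ℂ)‖ ≤ 1 + ‖c‖ := by
    refine (norm_sub_le _ _).trans ?_
    simp only [norm_one, norm_div, Complex.norm_natCast]
    gcongr
    exact div_le_self (norm_nonneg _) hn1
  have h1' : ‖Complex.GammaSeq t n‖ ≤ A := by simpa using h1
  refine (norm_add_le _ _).trans ?_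
  rw [norm_neg, norm_mul, norm_mul, norm_pow, norm_div, Complex.norm_natCast]
  calc _ ≤ 2 * K / (n : ℝ) ^ 2 * (1 + ‖c‖) + A * (‖c‖ / n) ^ 2 := by gcongr
    _ = _ := by ring
end

section
/- Let q ≥ 2, a > 0 and δ > 0 be real numbers, and let w < 1 be a real number that is not an integer. Then, as n → ∞, ∫_{q^{−a}}^{q^{−a(1−δ)}} u^{−(n+1)}·(u − q^{−a})^{−w} du = Γ(1−w)·q^{a(n+w)}·n^{w−1}·[1 + (w²−w)/(2n) + O(1/n²)], where the left-hand side is a real (absolutely convergent, improper at the left endpoint when 0 < w < 1) integral and Γ is the real Gamma function. -/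
open Filter Asymptotics intervalIntegral

/-- Second order expansion of a real power at `1`. -/
lemma aux_rpow_s9 (w : ℝ) :
    (fun y : ℝ => (1 + y) ^ (-w) - 1 + w * y) =O[nhds 0] (fun y : ℝ => y ^ 2) := by
  have han : AnalyticAt ℝ (fun x : ℝ => x ^ (-w)) 1 := by
    have : AnalyticAt ℝ (fun x : ℝ => Real.exp (Real.log x * (-w))) 1 := by
      have h1 : AnalyticAt ℝ Real.log 1 := analyticAt_log (by norm_num)
      exact (h1.mul analyticAt_const).rexp
    refine this.congr ?_
    filter_upwards [lt_mem_nhds (show (0 : ℝ) < 1 by norm_num)] with x hx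
    rw [Real.rpow_def_of_pos hx]
  obtain ⟨p, hp⟩ := han
  have hder : HasDerivAt (fun x : ℝ => x ^ (-w)) (-w) 1 := by
    simpa using Real.hasDerivAt_rpow_const (x := 1) (p := -w) (Or.inl one_ne_zero)
  have hd : p 1 (fun _ => 1) = -w := hp.hasDerivAt.unique hder
  have h0 : p.coeff 0 = 1 := by
    have := hp.coeff_zero (fun _ => 0)
    simpa using this
  have hO := hp.isBigO_sub_partialSum_pow 2
  have hd' : p.coeff 1 = -w := hd
  refine (hO.congr ?_ ?_)
  · intro y
    simp only [FormalMultilinearSeries.partialSum, Finset.sum_range_succ, Finset.sum_range_zero,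
      FormalMultilinearSeries.apply_eq_pow_smul_coeff, h0, hd']
    simp
    ring
  · intro y
    simp

lemma aux_h : (fun t : ℝ => (Real.exp t - 1) / t - 1 - t / 2) =O[nhdsWithin 0 (Set.Ioi 0)]
    (fun t : ℝ => t ^ 2) := by
  have h := (Real.exp_sub_sum_range_isBigO_pow 3).mono
    (nhdsWithin_le_nhds (s := Set.Ioi (0 : ℝ)))
  have h2 := h.mul (isBigO_refl (fun t : ℝ => t⁻¹) (nhdsWithin 0 (Set.Ioi 0)))
  refine h2.congr' ?_ ?_
  · filter_upwards [self_mem_nhdsWithin] with t ht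
    have : t ≠ 0 := ne_of_gt ht
    simp [Finset.sum_range_succ]
    field_simp
    ring
  · filter_upwards [self_mem_nhdsWithin] with t ht
    have : t ≠ 0 := ne_of_gt ht
    field_simp

lemma aux_g (w : ℝ) : (fun t : ℝ => ((Real.exp t - 1) / t) ^ (-w) - 1 + w * t / 2)
    =O[nhdsWithin 0 (Set.Ioi 0)] (fun t : ℝ => t ^ 2) := by
  have hsq : (fun t : ℝ => t ^ 2) =O[nhdsWithin 0 (Set.Ioi 0)] (fun t : ℝ => t) := by
    have := (IsBigO.of_bound 1 (by
      filter_upwards [Ioo_mem_nhdsGT (show (0 : ℝ) < 1 by norm_num)] with t ht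
      rw [Real.norm_eq_abs, Real.norm_eq_abs, abs_of_nonneg (sq_nonneg t), abs_of_pos ht.1]
      nlinarith [ht.1, ht.2]) :
      (fun t : ℝ => t ^ 2) =O[nhdsWithin 0 (Set.Ioi 0)] (fun t : ℝ => t))
    exact this
  have h1 : (fun t : ℝ => (Real.exp t - 1) / t - 1) =O[nhdsWithin 0 (Set.Ioi 0)]
      (fun t : ℝ => t) := by
    have h2 : (fun t : ℝ => t / 2) =O[nhdsWithin 0 (Set.Ioi 0)] (fun t : ℝ => t) := by
      have := (isBigO_refl (fun t : ℝ => t) (nhdsWithin 0 (Set.Ioi 0))).const_mul_left (1 / 2)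
      refine this.congr_left (fun t => by ring)
    refine ((aux_h.trans hsq).add h2).congr_left (fun t => by ring)
  have ht : Tendsto (fun t : ℝ => (Real.exp t - 1) / t - 1) (nhdsWithin 0 (Set.Ioi 0))
      (nhds 0) := h1.trans_tendsto (tendsto_id.mono_left nhdsWithin_le_nhds)
  have hA := ((aux_rpow_s9 w).comp_tendsto ht).trans (h1.pow 2)
  have hB := aux_h.const_mul_left (-w)
  refine (hA.add hB).congr_left (fun t => ?_)
  simp only [Function.comp]
  rw [show 1 + ((Real.exp t - 1) / t - 1) = (Real.exp t - 1) / t by ring]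
  ring

lemma aux_bound (w L : ℝ) (hL : 0 < L) : ∃ C : ℝ, 0 ≤ C ∧ ∀ t ∈ Set.Ioi (0 : ℝ),
    |(Set.Ioc 0 L).indicator (fun t => (Real.exp t - 1) ^ (-w)) t
      - t ^ (-w) + w / 2 * t ^ (1 - w)| ≤ C * t ^ (2 - w) := by
  obtain ⟨C1, hC1, hb⟩ := (aux_g w).exists_pos
  rw [IsBigOWith] at hb
  obtain ⟨ε, hε, hεb⟩ := (mem_nhdsGT_iff_exists_Ioo_subset).1 hb
  replace hε : (0 : ℝ) < ε := hε
  -- compact part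
  have hcont : ContinuousOn (fun t : ℝ => ((Real.exp t - 1) / t) ^ (-w) - 1 + w * t / 2)
      (Set.Icc ε L) := by
    have : ContinuousOn (fun t : ℝ => ((Real.exp t - 1) / t) ^ (-w)) (Set.Icc ε L) := by
      refine ContinuousOn.rpow_const ?_ ?_
      · refine ContinuousOn.div (by fun_prop) (by fun_prop) ?_
        intro t ht
        exact ne_of_gt (hε.trans_le ht.1)
      · intro t ht
        left
        have h0 : 0 < t := hε.trans_le ht.1
        have : 1 < Real.exp t := Real.one_lt_exp_iff.2 h0
        exact ne_of_gt (div_pos (by linarith) h0)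
    fun_prop
  obtain ⟨M, hM⟩ := isCompact_Icc.exists_bound_of_continuousOn hcont
  have hpw : ∀ t : ℝ, 0 < t → t ^ (1 - w) = t ^ (-w) * t ∧ t ^ (2 - w) = t ^ (-w) * t ^ 2 := by
    intro t ht
    constructor
    · rw [show 1 - w = -w + 1 by ring, Real.rpow_add ht, Real.rpow_one]
    · rw [show 2 - w = -w + 2 by ring, Real.rpow_add ht, Real.rpow_two]
  have hx0 : 0 ≤ |M| / ε ^ 2 := by positivity
  have hx1 : 0 ≤ 1 / L ^ 2 := by positivity
  have hx2 : 0 ≤ |w| / (2 * L) := by positivity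
  refine ⟨C1 + |M| / ε ^ 2 + 1 / L ^ 2 + |w| / (2 * L), by positivity, ?_⟩
  intro t ht
  have ht0 : (0 : ℝ) < t := ht
  obtain ⟨e1, e2⟩ := hpw t ht0
  have hp : 0 < t ^ (-w) := Real.rpow_pos_of_pos ht0 _
  have ht2 : 0 < t ^ 2 := by positivity
  rw [e1, e2]
  by_cases htL : t ≤ L
  · rw [Set.indicator_of_mem (show t ∈ Set.Ioc 0 L from ⟨ht0, htL⟩)]
    have hexp : 1 < Real.exp t := Real.one_lt_exp_iff.2 ht0
    have hpos : 0 < (Real.exp t - 1) / t := div_pos (by linarith) ht0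
    have e3 : (Real.exp t - 1) ^ (-w) = t ^ (-w) * ((Real.exp t - 1) / t) ^ (-w) := by
      rw [← Real.mul_rpow ht0.le hpos.le]
      congr 1
      field_simp
    have key : |((Real.exp t - 1) / t) ^ (-w) - 1 + w * t / 2| ≤
        (C1 + |M| / ε ^ 2) * t ^ 2 := by
      by_cases h : t < ε
      · have := hεb (show t ∈ Set.Ioo 0 ε from ⟨ht0, h⟩)
        simp only [Set.mem_ofPred_eq, Real.norm_eq_abs, abs_pow, sq_abs] at this
        nlinarith
      · push Not at h
        have := hM t ⟨h, htL⟩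
        rw [Real.norm_eq_abs] at this
        have h4 : |M| ≤ |M| / ε ^ 2 * t ^ 2 := by
          rw [div_mul_eq_mul_div, le_div_iff₀ (by positivity)]
          gcongr
        nlinarith [le_abs_self M]
    rw [e3, show t ^ (-w) * ((Real.exp t - 1) / t) ^ (-w) - t ^ (-w) + w / 2 * (t ^ (-w) * t)
      = t ^ (-w) * (((Real.exp t - 1) / t) ^ (-w) - 1 + w * t / 2) by ring, abs_mul,
      abs_of_pos hp]
    rw [show (C1 + |M| / ε ^ 2 + 1 / L ^ 2 + |w| / (2 * L)) * (t ^ (-w) * t ^ 2)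
      = t ^ (-w) * ((C1 + |M| / ε ^ 2 + 1 / L ^ 2 + |w| / (2 * L)) * t ^ 2) by ring]
    refine mul_le_mul_of_nonneg_left ?_ hp.le
    nlinarith
  · rw [Set.indicator_of_notMem (fun h => htL h.2)]
    push Not at htL
    rw [show 0 - t ^ (-w) + w / 2 * (t ^ (-w) * t)
      = t ^ (-w) * (w / 2 * t - 1) by ring, abs_mul, abs_of_pos hp]
    rw [show (C1 + |M| / ε ^ 2 + 1 / L ^ 2 + |w| / (2 * L)) * (t ^ (-w) * t ^ 2)
      = t ^ (-w) * ((C1 + |M| / ε ^ 2 + 1 / L ^ 2 + |w| / (2 * L)) * t ^ 2) by ring]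
    refine mul_le_mul_of_nonneg_left ?_ hp.le
    have h1 : 1 ≤ 1 / L ^ 2 * t ^ 2 := by
      rw [div_mul_eq_mul_div, le_div_iff₀ (by positivity)]
      nlinarith
    have h2 : |w| / 2 * t ≤ |w| / (2 * L) * t ^ 2 := by
      rw [div_mul_eq_mul_div, div_mul_eq_mul_div, div_le_div_iff₀ (by positivity) (by positivity)]
      have : 0 ≤ |w| * t := by positivity
      nlinarith
    have h3 : |w / 2 * t - 1| ≤ |w| / 2 * t + 1 := by
      refine (abs_sub _ _).trans ?_
      rw [abs_mul, abs_div, abs_of_pos ht0]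
      simp
    nlinarith

lemma aux_int (s r : ℝ) (hs : 0 < s) (hr : 0 < r) :
    MeasureTheory.IntegrableOn (fun t : ℝ => t ^ (s - 1) * Real.exp (-(r * t))) (Set.Ioi 0) := by
  have := integrableOn_rpow_mul_exp_neg_mul_rpow (p := 1) (s := s - 1) (b := r)
    (by linarith) one_pos hr
  simpa using this

lemma aux_val (s r : ℝ) (hs : 0 < s) (hr : 0 < r) :
    ∫ t in Set.Ioi (0 : ℝ), t ^ (s - 1) * Real.exp (-(r * t)) = Real.Gamma s * r ^ (-s) := by
  rw [Real.integral_rpow_mul_exp_neg_mul_Ioi hs hr, one_div, Real.inv_rpow hr.le,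
    Real.rpow_neg hr.le, mul_comm]

/-- Watson-type estimate. -/
lemma aux_watson (w L : ℝ) (hw : w < 1) (hL : 0 < L) : ∃ C : ℝ, ∀ r : ℝ, 0 < r →
    |(∫ t in Set.Ioc 0 L, (Real.exp t - 1) ^ (-w) * Real.exp (-(r * t)))
      - Real.Gamma (1 - w) * r ^ (w - 1) + w / 2 * (Real.Gamma (2 - w) * r ^ (w - 2))|
      ≤ C * r ^ (w - 3) := by
  obtain ⟨C, hC, hb⟩ := aux_bound w L hL
  refine ⟨C * Real.Gamma (3 - w), fun r hr => ?_⟩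
  have i1 := aux_int (1 - w) r (by linarith) hr
  have i2 := aux_int (2 - w) r (by linarith) hr
  have i3 := aux_int (3 - w) r (by linarith) hr
  have v1 := aux_val (1 - w) r (by linarith) hr
  have v2 := aux_val (2 - w) r (by linarith) hr
  have v3 := aux_val (3 - w) r (by linarith) hr
  rw [show 1 - w - 1 = -w by ring] at i1 v1
  rw [show 2 - w - 1 = 1 - w by ring] at i2 v2
  rw [show 3 - w - 1 = 2 - w by ring] at i3 v3
  rw [show -(1 - w) = w - 1 by ring] at v1
  rw [show -(2 - w) = w - 2 by ring] at v2
  rw [show -(3 - w) = w - 3 by ring] at v3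
  set F : ℝ → ℝ := (Set.Ioc 0 L).indicator (fun t => (Real.exp t - 1) ^ (-w)) with hF
  have hFm : Measurable F := by
    refine Measurable.indicator ?_ measurableSet_Ioc
    exact ((Real.measurable_exp.sub_const 1).pow_const (-w))
  set G : ℝ → ℝ := fun t => (F t - t ^ (-w) + w / 2 * t ^ (1 - w)) * Real.exp (-(r * t)) with hG
  have hGm : Measurable G := by
    have a1 : Measurable (fun t : ℝ => t ^ (-w)) := measurable_id.pow_const _
    have a2 : Measurable (fun t : ℝ => t ^ (1 - w)) := measurable_id.pow_const _
    exact ((hFm.sub a1).add (a2.const_mul _)).mul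
      (Real.measurable_exp.comp (measurable_id.const_mul r).neg)
  have hGb : ∀ t ∈ Set.Ioi (0 : ℝ), ‖G t‖ ≤ C * (t ^ (2 - w) * Real.exp (-(r * t))) := by
    intro t ht
    rw [hG, Real.norm_eq_abs, abs_mul, abs_of_pos (Real.exp_pos _), ← mul_assoc]
    exact mul_le_mul_of_nonneg_right (hb t ht) (Real.exp_pos _).le
  have hGb' : ∀ᵐ t ∂(MeasureTheory.volume.restrict (Set.Ioi (0 : ℝ))),
      ‖G t‖ ≤ C * (t ^ (2 - w) * Real.exp (-(r * t))) :=
    (MeasureTheory.ae_restrict_iff' measurableSet_Ioi).2 (Filter.Eventually.of_forall hGb)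
  have hGi : MeasureTheory.IntegrableOn G (Set.Ioi 0) :=
    MeasureTheory.Integrable.mono' (i3.const_mul C) hGm.aestronglyMeasurable hGb'
  have hGle := MeasureTheory.norm_integral_le_of_norm_le (i3.const_mul C) hGb'
  rw [MeasureTheory.integral_const_mul, v3] at hGle
  have hsplit : ∫ t in Set.Ioi (0 : ℝ), F t * Real.exp (-(r * t)) =
      (∫ t in Set.Ioi (0 : ℝ), G t) + (∫ t in Set.Ioi (0 : ℝ), t ^ (-w) * Real.exp (-(r * t)))
      - ∫ t in Set.Ioi (0 : ℝ), w / 2 * (t ^ (1 - w) * Real.exp (-(r * t))) := by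
    have i4 : MeasureTheory.IntegrableOn (fun t => G t + t ^ (-w) * Real.exp (-(r * t)))
      (Set.Ioi 0) := hGi.add i1
    rw [← MeasureTheory.integral_add hGi i1, ← MeasureTheory.integral_sub i4
      (i2.const_mul (w / 2))]
    congr 1
    ext t
    simp only [hG]
    ring
  have hset : ∫ t in Set.Ioi (0 : ℝ), F t * Real.exp (-(r * t)) =
      ∫ t in Set.Ioc 0 L, (Real.exp t - 1) ^ (-w) * Real.exp (-(r * t)) := by
    have : (fun t => F t * Real.exp (-(r * t))) =
        (Set.Ioc 0 L).indicator (fun t => (Real.exp t - 1) ^ (-w) * Real.exp (-(r * t))) := by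
      ext t
      simp only [hF, Set.indicator_apply]
      split_ifs <;> simp
    rw [this, MeasureTheory.setIntegral_indicator measurableSet_Ioc]
    congr 2
    exact Set.inter_eq_right.2 Set.Ioc_subset_Ioi_self
  rw [← hset, hsplit, v1, MeasureTheory.integral_const_mul, v2, ← Real.norm_eq_abs]
  calc _ = ‖∫ t in Set.Ioi (0 : ℝ), G t‖ := by congr 1; ring
    _ ≤ _ := by linarith [hGle]

lemma aux_subst (c L w : ℝ) (hc : 0 < c) (hL : 0 < L) (n : ℕ) :
    (∫ u in c..(c * Real.exp L), u ^ (-((n : ℤ) + 1)) * (u - c) ^ (-w)) =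
      c ^ (-((n : ℝ) + w)) *
        ∫ t in Set.Ioc 0 L, (Real.exp t - 1) ^ (-w) * Real.exp (-((n : ℝ) * t)) := by
  have hle : c ≤ c * Real.exp L := by
    nlinarith [Real.one_lt_exp_iff.2 hL]
  have himg : (fun t => c * Real.exp t) '' Set.Ioc 0 L = Set.Ioc c (c * Real.exp L) := by
    ext u
    constructor
    · rintro ⟨t, ⟨h0, h1⟩, rfl⟩
      refine ⟨?_, ?_⟩
      · show c < c * Real.exp t
        nlinarith [Real.one_lt_exp_iff.2 h0]
      · show c * Real.exp t ≤ c * Real.exp L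
        gcongr
    · rintro ⟨h0, h1⟩
      have hu : 0 < u / c := div_pos (hc.trans h0) hc
      refine ⟨Real.log (u / c), ⟨Real.log_pos ((one_lt_div hc).2 h0), ?_⟩, ?_⟩
      · rw [Real.log_le_iff_le_exp hu, div_le_iff₀ hc]
        linarith
      · show c * Real.exp (Real.log (u / c)) = u
        rw [Real.exp_log hu]
        field_simp
  rw [intervalIntegral.integral_of_le hle, ← himg,
    MeasureTheory.integral_image_eq_integral_abs_deriv_smul (f' := fun t => c * Real.exp t)
      measurableSet_Ioc
      (fun t _ => ((Real.hasDerivAt_exp t).const_mul c).hasDerivWithinAt)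
      (fun x _ y _ h => Real.exp_injective (mul_left_cancel₀ hc.ne' h)),
    ← MeasureTheory.integral_const_mul]
  refine MeasureTheory.setIntegral_congr_fun measurableSet_Ioc (fun t ht => ?_)
  have h1 : 0 ≤ Real.exp t - 1 := by linarith [Real.one_lt_exp_iff.2 ht.1]
  have he := Real.exp_pos t
  have hce : 0 < c * Real.exp t := by positivity
  simp only [smul_eq_mul]
  rw [abs_of_pos hce, show c * Real.exp t - c = c * (Real.exp t - 1) by ring,
    Real.mul_rpow hc.le h1, zpow_neg, zpow_add_one₀ hce.ne', zpow_natCast, neg_add,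
    Real.rpow_add hc, Real.rpow_neg hc.le (n : ℝ), Real.rpow_natCast, Real.exp_neg, Real.exp_nat_mul]
  field_simp
  rw [mul_pow]
  ring

theorem stmt9 (q a δ w : ℝ) (hq : 2 ≤ q) (ha : 0 < a) (hδ : 0 < δ)
    (hw1 : w < 1) (hwz : ∀ m : ℤ, w ≠ (m : ℝ)) :
    (fun n : ℕ =>
        (∫ u in (q ^ (-a))..(q ^ (-(a * (1 - δ)))),
          u ^ (-((n : ℤ) + 1)) * (u - q ^ (-a)) ^ (-w)) -
        Real.Gamma (1 - w) * q ^ (a * ((n : ℝ) + w)) * (n : ℝ) ^ (w - 1) *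
          (1 + (w ^ 2 - w) / (2 * (n : ℝ))))
      =O[atTop] (fun n : ℕ => q ^ (a * ((n : ℝ) + w)) * (n : ℝ) ^ (w - 3)) := by
  have hq0 : 0 < q := by linarith
  have hlog : 0 < Real.log q := Real.log_pos (by linarith)
  have hL : 0 < Real.log q * (a * δ) := by positivity
  have hc : 0 < q ^ (-a) := Real.rpow_pos_of_pos hq0 _
  obtain ⟨C, hC⟩ := aux_watson w _ hw1 hL
  refine IsBigO.of_bound C ?_
  filter_upwards [eventually_gt_atTop 0] with n hn
  have hn0 : (0 : ℝ) < n := by exact_mod_cast hn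
  have hup : q ^ (-(a * (1 - δ))) = q ^ (-a) * Real.exp (Real.log q * (a * δ)) := by
    rw [← Real.rpow_def_of_pos hq0, ← Real.rpow_add hq0]
    congr 1
    ring
  have hcq : (q ^ (-a)) ^ (-((n : ℝ) + w)) = q ^ (a * ((n : ℝ) + w)) := by
    rw [← Real.rpow_mul hq0.le]
    congr 1
    ring
  rw [hup, aux_subst _ _ w hc hL n, hcq]
  have hQ : 0 < q ^ (a * ((n : ℝ) + w)) := Real.rpow_pos_of_pos hq0 _
  have hN : 0 < (n : ℝ) ^ (w - 3) := Real.rpow_pos_of_pos hn0 _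
  have hG : Real.Gamma (2 - w) = (1 - w) * Real.Gamma (1 - w) := by
    rw [← Real.Gamma_add_one (by linarith)]
    congr 1
    ring
  have hp : (n : ℝ) ^ (w - 1) = (n : ℝ) ^ (w - 2) * n := by
    rw [show w - 1 = w - 2 + 1 by ring, Real.rpow_add hn0, Real.rpow_one]
  have h := hC n hn0
  rw [Real.norm_of_nonneg (mul_pos hQ hN).le]
  have e : ∀ I : ℝ, q ^ (a * ((n : ℝ) + w)) * I -
      Real.Gamma (1 - w) * q ^ (a * ((n : ℝ) + w)) * (n : ℝ) ^ (w - 1) *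
          (1 + (w ^ 2 - w) / (2 * (n : ℝ))) =
      q ^ (a * ((n : ℝ) + w)) * (I - Real.Gamma (1 - w) * (n : ℝ) ^ (w - 1)
        + w / 2 * (Real.Gamma (2 - w) * (n : ℝ) ^ (w - 2))) := by
    intro I
    rw [hG, hp]
    field_simp
    ring
  rw [e, Real.norm_eq_abs, abs_mul, abs_of_pos hQ]
  calc _ ≤ q ^ (a * ((n : ℝ) + w)) * (C * (n : ℝ) ^ (w - 3)) :=
        mul_le_mul_of_nonneg_left h hQ.le
    _ = _ := by ring
end
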